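/- Fix an integer M ≥ 4. For every complex number s = σ + iτ with σ = Re s > 1, ∑_{n=1}^{∞} Λ(n)²/n^s = ∑_{m=1}^{M} (b_m/m²)·( 1/(s − 1/m)² − ∑*_ρ 1/(s − ρ/m)² ) + O(M·2^{−σM}), where ∑*_ρ runs over ALL zeros ρ of the Riemann zeta function — both the trivial zeros ρ = −2, −4, −6, … and the nontrivial zeros counted with multiplicity — and the implied constant is absolute. -/

import Mathlib

open Complex

/-- The multiplicity (order of vanishing) of `f` at `ρ`: the largest `n` such that
`f z = (z - ρ)^n g z` near `ρ` for some function `g` analytic at `ρ`.  It is `0` when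
`f ρ ≠ 0`, and also (junk value) at poles of `f`. -/
noncomputable def zeroMult (f : ℂ → ℂ) (ρ : ℂ) : ℕ :=
  sSup {n : ℕ | ∃ g : ℂ → ℂ, AnalyticAt ℂ g ρ ∧ ∀ᶠ z in nhds ρ, f z = (z - ρ) ^ n * g z}

/-- The radical (squarefree kernel) of a natural number: the product of its prime factors. -/
def Nat.rad (m : ℕ) : ℕ := ∏ p ∈ m.primeFactors, p

/-- `b m = μ(rad m) · φ(rad m)`. -/
noncomputable def bcoef (m : ℕ) : ℤ :=
  ArithmeticFunction.moebius m.rad * (Nat.totient m.rad : ℤ)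

open Filter Topology in
/-- Dividing an entire function by the full power of `z - a` at one of its zeros. -/
lemma Differentiable.exists_eq_sub_pow_mul {f : ℂ → ℂ} (hf : Differentiable ℂ f) {a : ℂ}
    (ha : analyticOrderAt f a ≠ ⊤) :
    ∃ g : ℂ → ℂ, Differentiable ℂ g ∧ g a ≠ 0 ∧
      ∀ z, f z = (z - a) ^ analyticOrderNatAt f a * g z := by
  obtain ⟨g₀, hg₀, hg₀a, heq⟩ := (hf.analyticAt a).analyticOrderAt_ne_top.1 ha
  set n := analyticOrderNatAt f a
  classical
  set g : ℂ → ℂ := fun z ↦ if z = a then g₀ a else f z / (z - a) ^ n with hg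
  have hga : g =ᶠ[𝓝 a] g₀ := by
    filter_upwards [heq] with z hz
    by_cases hza : z = a
    · simp [hg, hza]
    · have : (z - a) ^ n ≠ 0 := pow_ne_zero _ (sub_ne_zero.2 hza)
      simp only [hg, hza, if_false, hz, smul_eq_mul]
      field_simp
  refine ⟨g, fun z ↦ ?_, by simpa [hg] using hg₀a, fun z ↦ ?_⟩
  · by_cases hza : z = a
    · subst hza
      exact (hg₀.congr hga.symm).differentiableAt
    · have : g =ᶠ[𝓝 z] fun w ↦ f w / (w - a) ^ n := by
        filter_upwards [isOpen_ne.mem_nhds hza] with w hw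
        simp [hg, show w ≠ a from hw]
      refine DifferentiableAt.congr_of_eventuallyEq ?_ this
      exact (hf z).div (by fun_prop) (pow_ne_zero _ (sub_ne_zero.2 hza))
  · by_cases hza : z = a
    · subst hza
      have := heq.self_of_nhds
      simpa [hg] using this
    · have : (z - a) ^ n ≠ 0 := pow_ne_zero _ (sub_ne_zero.2 hza)
      simp only [hg, hza, if_false]
      field_simp

/-- Dividing an entire function by all its zeros in a finite set. -/
lemma Differentiable.exists_eq_prod_sub_pow_mul {f : ℂ → ℂ} (hf : Differentiable ℂ f)
    (hfin : ∀ z, analyticOrderAt f z ≠ ⊤) (S : Finset ℂ) :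
    ∃ g : ℂ → ℂ, Differentiable ℂ g ∧ (∀ a ∈ S, g a ≠ 0) ∧
      ∀ z, f z = (∏ a ∈ S, (z - a) ^ analyticOrderNatAt f a) * g z := by
  classical
  induction S using Finset.induction_on with
  | empty => exact ⟨f, hf, by simp, by simp⟩
  | insert a S ha ih =>
    obtain ⟨g, hg, hgS, hfg⟩ := ih
    set P : ℂ → ℂ := fun z ↦ ∏ a ∈ S, (z - a) ^ analyticOrderNatAt f a with hP
    have hPd : Differentiable ℂ P := by fun_prop
    have hPa : P a ≠ 0 := by
      refine Finset.prod_ne_zero_iff.2 fun b hb ↦ pow_ne_zero _ (sub_ne_zero.2 ?_)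
      rintro rfl; exact ha hb
    have hord : analyticOrderAt f a = analyticOrderAt g a := by
      have h1 : f = P * g := funext hfg
      conv_lhs => rw [h1]
      rw [analyticOrderAt_mul (hPd.analyticAt a) (hg.analyticAt a),
        (hPd.analyticAt a).analyticOrderAt_eq_zero.2 hPa, zero_add]
    obtain ⟨g', hg', hg'a, hgg'⟩ := hg.exists_eq_sub_pow_mul (hord ▸ hfin a)
    have hord' : analyticOrderNatAt g a = analyticOrderNatAt f a := by
      simp [analyticOrderNatAt, hord]
    refine ⟨g', hg', fun b hb ↦ ?_, fun z ↦ ?_⟩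
    · rcases Finset.mem_insert.1 hb with rfl | hb
      · exact hg'a
      · intro h0
        exact hgS b hb (by rw [hgg', h0, mul_zero])
    · rw [Finset.prod_insert ha, hfg z, hgg' z, hord']
      ring

/-- A nonvanishing holomorphic function on a disc centred at `0` has a holomorphic logarithm. -/
lemma exists_exp_eq_of_ne_zero_on_ball {g : ℂ → ℂ} {R : ℝ} (hR : 0 < R)
    (hg : DifferentiableOn ℂ g (Metric.ball 0 R)) (h0 : ∀ z ∈ Metric.ball (0 : ℂ) R, g z ≠ 0)
    (hg0 : g 0 = 1) :
    ∃ h : ℂ → ℂ, h 0 = 0 ∧ (∀ z ∈ Metric.ball (0 : ℂ) R, HasDerivAt h (logDeriv g z) z) ∧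
      ∀ z ∈ Metric.ball (0 : ℂ) R, exp (h z) = g z := by
  have hU : IsOpen (Metric.ball (0 : ℂ) R) := Metric.isOpen_ball
  have hd : DifferentiableOn ℂ (logDeriv g) (Metric.ball 0 R) := (hg.deriv hU).div hg h0
  obtain ⟨H, hH⟩ := hd.isExactOn_ball
  have hH' : ∀ z ∈ Metric.ball (0 : ℂ) R,
      HasDerivAt (fun z ↦ H z - H 0) (logDeriv g z) z := fun z hz ↦ (hH z hz).sub_const _
  refine ⟨fun z ↦ H z - H 0, by simp, hH', fun z hz ↦ ?_⟩
  have hcd : ∀ z ∈ Metric.ball (0 : ℂ) R,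
      HasDerivAt (fun z ↦ g z * exp (-(H z - H 0))) 0 z := by
    intro z hz
    have h1 := (hg.differentiableAt (hU.mem_nhds hz)).hasDerivAt.mul (hH' z hz).neg.cexp
    convert! h1 using 1
    have := h0 z hz
    rw [logDeriv_apply]
    field_simp
    ring
  have hconst := (convex_ball (0 : ℂ) R).is_const_of_fderivWithin_eq_zero (𝕜 := ℂ)
    (f := fun z ↦ g z * exp (-(H z - H 0)))
    (fun z hz ↦ (hcd z hz).differentiableAt.differentiableWithinAt)
    (fun z hz ↦ by
      rw [fderivWithin_of_isOpen hU hz]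
      ext
      rw [fderiv_apply_one_eq_deriv, (hcd z hz).deriv]
      simp)
    hz (Metric.mem_ball_self hR)
  simp only [sub_self, neg_zero, exp_zero, mul_one, hg0, exp_neg] at hconst
  field_simp at hconst
  exact hconst.symm

/-- Local bounds for an entire function of controlled growth, after dividing out its zeros in a
disc: the number of zeros is bounded, and the second logarithmic derivative is close to the
contribution of these zeros. -/
lemma sum_zeros_bounds {f : ℂ → ℂ} (hf : Differentiable ℂ f)
    (hfin : ∀ z, analyticOrderAt f z ≠ ⊤) (hf0 : f 0 ≠ 0) {B R : ℝ} (hR : 0 < R)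
    (hB : ∀ z, ‖z‖ = 3 * R → ‖f z‖ ≤ ‖f 0‖ * Real.exp B) (Z : Finset ℂ)
    (hZR : ∀ a ∈ Z, ‖a‖ ≤ R) (hZ : ∀ z, ‖z‖ ≤ R → f z = 0 → z ∈ Z) :
    (∑ a ∈ Z, (analyticOrderNatAt f a : ℝ)) * Real.log 2 ≤ B ∧
    ∀ z, ‖z‖ ≤ R / 4 → f z ≠ 0 →
      ‖deriv (logDeriv f) z + ∑ a ∈ Z, (analyticOrderNatAt f a : ℂ) / (z - a) ^ 2‖ ≤
        64 * (B + 1) / R ^ 2 := by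
  obtain ⟨g, hg, hgZ, hfg⟩ := hf.exists_eq_prod_sub_pow_mul hfin Z
  set m := analyticOrderNatAt f with hm
  set P : ℂ → ℂ := fun z ↦ ∏ a ∈ Z, (z - a) ^ m a with hP
  have hfg' : ∀ z, f z = P z * g z := hfg
  have hPd : Differentiable ℂ P := by fun_prop
  have hg0 : g 0 ≠ 0 := fun h ↦ hf0 (by rw [hfg', h, mul_zero])
  have hP0 : P 0 ≠ 0 := fun h ↦ hf0 (by rw [hfg', h, zero_mul])
  set N : ℕ := ∑ a ∈ Z, m a with hN
  have hPlow : ∀ z, ‖z‖ = 3 * R → 2 ^ N * ‖P 0‖ ≤ ‖P z‖ := by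
    intro z hz
    simp only [hP, hN, norm_prod, norm_pow, zero_sub, norm_neg, ← Finset.prod_pow_eq_pow_sum,
      ← Finset.prod_mul_distrib, ← mul_pow]
    refine Finset.prod_le_prod (fun a _ ↦ by positivity) fun a ha ↦ ?_
    gcongr
    have h1 := norm_sub_norm_le z a
    have h2 := hZR a ha
    linarith
  have hgsph : ∀ z, ‖z‖ = 3 * R → ‖g z‖ ≤ ‖g 0‖ * (Real.exp B / 2 ^ N) := by
    intro z hz
    have h1 := hB z hz
    rw [hfg' z, hfg' 0, norm_mul, norm_mul] at h1
    have h2 : 2 ^ N * ‖P 0‖ * ‖g z‖ ≤ ‖P 0‖ * ‖g 0‖ * Real.exp B :=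
      (mul_le_mul_of_nonneg_right (hPlow z hz) (norm_nonneg _)).trans h1
    have h3 : 0 < ‖P 0‖ := norm_pos_iff.2 hP0
    rw [← mul_div_assoc, le_div_iff₀ (by positivity)]
    refine le_of_mul_le_mul_left ?_ h3
    linarith
  have hgball : ∀ z ∈ Metric.ball (0 : ℂ) (3 * R), ‖g z‖ ≤ ‖g 0‖ * (Real.exp B / 2 ^ N) := by
    intro z hz
    refine norm_le_of_forall_mem_frontier_norm_le Metric.isBounded_ball hg.diffContOnCl ?_
      (subset_closure hz)
    intro w hw
    exact hgsph w (by simpa using Metric.frontier_ball_subset_sphere hw)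
  have hpow : (2 : ℝ) ^ N ≤ Real.exp B := by
    have h1 := hgball 0 (Metric.mem_ball_self (by positivity))
    have h3 : 0 < ‖g 0‖ := norm_pos_iff.2 hg0
    have h2 : 1 ≤ Real.exp B / 2 ^ N := le_of_mul_le_mul_left (by simpa using h1) h3
    rwa [le_div_iff₀ (by positivity), one_mul] at h2
  have hcount : (∑ a ∈ Z, (m a : ℝ)) * Real.log 2 ≤ B := by
    have h1 := Real.log_le_log (by positivity) hpow
    rw [Real.log_pow, Real.log_exp] at h1
    simpa [hN] using h1
  refine ⟨hcount, fun z hz hfz ↦ ?_⟩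
  have hB0 : 0 ≤ B := le_trans (by positivity) hcount
  have hgne : ∀ w ∈ Metric.ball (0 : ℂ) R, g w ≠ 0 := by
    intro w hw h0
    exact hgZ w (hZ w (by simpa using (Metric.mem_ball.1 hw).le) (by rw [hfg', h0, mul_zero])) h0
  set G : ℂ → ℂ := fun w ↦ (g 0)⁻¹ * g w with hG
  have hGne : ∀ w ∈ Metric.ball (0 : ℂ) R, G w ≠ 0 := fun w hw ↦
    mul_ne_zero (inv_ne_zero hg0) (hgne w hw)
  obtain ⟨h, h0, hderiv, hexp⟩ := exists_exp_eq_of_ne_zero_on_ball (g := G) hR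
    (by fun_prop) hGne (by simp [hG, hg0])
  have hlog : ∀ w, logDeriv G w = logDeriv g w := fun w ↦
    logDeriv_const_mul w _ (inv_ne_zero hg0)
  have hhd : DifferentiableOn ℂ h (Metric.ball 0 R) := fun w hw ↦
    (hderiv w hw).differentiableAt.differentiableWithinAt
  have hmaps : Set.MapsTo h (Metric.ball 0 R) {z | z.re ≤ B + 1} := by
    intro w hw
    have h1 : ‖G w‖ ≤ Real.exp B := by
      have h3 : 0 < ‖g 0‖ := norm_pos_iff.2 hg0
      have h2 := hgball w (Metric.ball_subset_ball (by linarith) hw)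
      simp only [hG, norm_mul, norm_inv]
      rw [inv_mul_le_iff₀ h3]
      refine h2.trans ?_
      gcongr
      exact div_le_self (Real.exp_pos B).le (one_le_pow₀ (by norm_num))
    rw [← hexp w hw, norm_exp, Real.exp_le_exp] at h1
    show (h w).re ≤ B + 1
    linarith
  have hhb : ∀ w, ‖w‖ ≤ R / 2 → ‖h w‖ ≤ 2 * (B + 1) := by
    intro w hw
    have h1 := borelCaratheodory_zero (by linarith) hhd hmaps hR
      (by simpa using lt_of_le_of_lt hw (by linarith)) h0
    refine h1.trans ?_
    rw [div_le_iff₀ (by linarith)]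
    nlinarith
  have hsub : Metric.ball z (R / 4) ⊆ Metric.ball 0 R := by
    intro w hw
    have h1 : ‖w - z‖ < R / 4 := by simpa [dist_eq_norm] using hw
    have h2 : ‖w‖ ≤ ‖w - z‖ + ‖z‖ := by simpa using norm_add_le (w - z) z
    simp only [Metric.mem_ball, dist_zero_right]
    linarith
  have hcauchy := norm_iteratedDeriv_le_of_forall_mem_sphere_norm_le (f := h) (c := z)
    (R := R / 4) (C := 2 * (B + 1)) 2 (by positivity)
    (DifferentiableOn.diffContOnCl (hhd.mono (by
      refine Metric.closure_ball_subset_closedBall.trans fun w hw ↦ ?_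
      have h1 : ‖w - z‖ ≤ R / 4 := by simpa [dist_eq_norm] using hw
      have h2 : ‖w‖ ≤ ‖w - z‖ + ‖z‖ := by simpa using norm_add_le (w - z) z
      simp only [Metric.mem_ball, dist_zero_right]
      linarith)))
    (fun w hw ↦ hhb w (by
      have h1 : ‖w - z‖ = R / 4 := by simpa [dist_eq_norm] using hw
      have h2 : ‖w‖ ≤ ‖w - z‖ + ‖z‖ := by simpa using norm_add_le (w - z) z
      linarith))
  have hzR : z ∈ Metric.ball (0 : ℂ) R := by simpa using lt_of_le_of_lt hz (by linarith)
  have hiter : iteratedDeriv 2 h z = deriv (logDeriv g) z := by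
    rw [iteratedDeriv_succ, iteratedDeriv_one]
    refine Filter.EventuallyEq.deriv_eq ?_
    filter_upwards [Metric.isOpen_ball.mem_nhds hzR] with w hw
    rw [(hderiv w hw).deriv, hlog]
  have hza : ∀ a ∈ Z, m a ≠ 0 → z - a ≠ 0 := by
    intro a ha hma h
    rw [sub_eq_zero] at h
    subst h
    exact hfz (apply_eq_zero_of_analyticOrderNatAt_ne_zero hma)
  have hPz : P z ≠ 0 := fun h ↦ hfz (by rw [hfg', h, zero_mul])
  have hgz : g z ≠ 0 := fun h ↦ hfz (by rw [hfg', h, mul_zero])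
  have hlogf : logDeriv f =ᶠ[nhds z] fun w ↦ (∑ a ∈ Z, (m a : ℂ) / (w - a)) + logDeriv g w := by
    have hP' := hPd.continuous.continuousAt.eventually_ne hPz
    have hg' := hg.continuous.continuousAt.eventually_ne hgz
    filter_upwards [hP', hg'] with w hPw hgw
    have h1 : f = fun w ↦ P w * g w := funext hfg'
    rw [h1, logDeriv_mul w hPw hgw (hPd w) (hg w), hP, logDeriv_prod]
    · congr 1
      refine Finset.sum_congr rfl fun a ha ↦ ?_
      rw [logDeriv_fun_pow (by fun_prop)]
      simp [logDeriv_apply, div_eq_mul_inv]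
    · intro a ha h
      exact hPw (Finset.prod_eq_zero ha h)
    · intro a ha
      fun_prop
  have hdg : DifferentiableAt ℂ (logDeriv g) z := by
    have : AnalyticAt ℂ (logDeriv g) z := (hg.analyticAt z).deriv.div (hg.analyticAt z) hgz
    exact this.differentiableAt
  have hterm : ∀ a ∈ Z, HasDerivAt (fun w ↦ (m a : ℂ) / (w - a)) (-(m a / (z - a) ^ 2)) z := by
    intro a ha
    by_cases hma : m a = 0
    · simpa [hma] using hasDerivAt_const z (0 : ℂ)
    · have h1 := ((hasDerivAt_id z).sub_const a).inv (hza a ha hma)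
      convert! h1.const_mul (m a : ℂ) using 1
      simp only [id]
      ring
  have hdd : deriv (logDeriv f) z =
      (∑ a ∈ Z, -((m a : ℂ) / (z - a) ^ 2)) + deriv (logDeriv g) z := by
    rw [hlogf.deriv_eq]
    exact ((HasDerivAt.fun_sum hterm).add hdg.hasDerivAt).deriv
  rw [hdd, Finset.sum_neg_distrib, neg_add_cancel_comm, ← hiter]
  refine hcauchy.trans (le_of_eq ?_)
  norm_num [Nat.factorial]
  field_simp
  ring

lemma Differentiable.finite_zeros_closedBall {f : ℂ → ℂ} (hf : Differentiable ℂ f)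
    {w : ℂ} (hw : f w ≠ 0) (R : ℝ) : {z | ‖z‖ ≤ R ∧ f z = 0}.Finite := by
  have h := AnalyticOnNhd.preimage_zero_mem_codiscrete (fun z _ ↦ hf.analyticAt z) hw
  rw [mem_codiscrete'] at h
  have hc : IsClosed (f ⁻¹' {0}) := isClosed_singleton.preimage hf.continuous
  have hd : IsDiscrete (f ⁻¹' {0}) := by
    have := h.2
    rwa [Set.preimage_compl, compl_compl] at this
  refine (((isCompact_closedBall (0 : ℂ) R).inter_right hc).finite
    (hd.mono Set.inter_subset_right)).subset ?_
  rintro z ⟨h1, h2⟩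
  exact ⟨by simpa using h1, h2⟩

section ControlledGrowth

variable {f : ℂ → ℂ} {C : ℝ}

lemma analyticOrderAt_ne_top_of_entire (hf : Differentiable ℂ f) {w : ℂ} (hw : f w ≠ 0) (z : ℂ) :
    analyticOrderAt f z ≠ ⊤ := by
  refine AnalyticOnNhd.analyticOrderAt_ne_top_of_isPreconnected (x := w) (U := Set.univ)
    (fun z _ ↦ hf.analyticAt z) isPreconnected_univ (Set.mem_univ _) (Set.mem_univ _) ?_
  rw [(hf.analyticAt w).analyticOrderAt_eq_zero.2 hw]
  simp

/-- Radius-`R` version of `sum_zeros_bounds` for an entire function of growth `exp (O(|z|^(3/2)))`. -/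
lemma exists_zeros_bounds (hf : Differentiable ℂ f) (hf0 : f 0 ≠ 0) (hC : 0 ≤ C)
    (hgr : ∀ z, ‖f z‖ ≤ Real.exp (C * (1 + ‖z‖) ^ (3 / 2 : ℝ))) :
    ∃ K : ℝ, 0 ≤ K ∧ ∀ R : ℝ, 1 ≤ R → ∃ Z : Finset ℂ,
      (∀ a, a ∈ Z ↔ ‖a‖ ≤ R ∧ f a = 0) ∧
      (∑ a ∈ Z, (analyticOrderNatAt f a : ℝ)) ≤ K * R ^ (3 / 2 : ℝ) ∧
      ∀ z, ‖z‖ ≤ R / 4 → f z ≠ 0 →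
        ‖deriv (logDeriv f) z + ∑ a ∈ Z, (analyticOrderNatAt f a : ℂ) / (z - a) ^ 2‖ ≤
          K * R ^ (3 / 2 : ℝ) / R ^ 2 := by
  set L : ℝ := C * 4 ^ (3 / 2 : ℝ) + |Real.log ‖f 0‖| with hL
  have hL0 : 0 ≤ L := by positivity
  have hlog2 : 1 / 2 ≤ Real.log 2 := by linarith [Real.log_two_gt_d9]
  refine ⟨64 * (L + 1), by positivity, fun R hR ↦ ?_⟩
  have hR1 : 1 ≤ R ^ (3 / 2 : ℝ) := Real.one_le_rpow hR (by norm_num)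
  have hfin := hf.finite_zeros_closedBall hf0 R
  have hmem : ∀ a, a ∈ hfin.toFinset ↔ ‖a‖ ≤ R ∧ f a = 0 := by simp
  have hB : ∀ z, ‖z‖ = 3 * R → ‖f z‖ ≤ ‖f 0‖ * Real.exp (L * R ^ (3 / 2 : ℝ)) := by
    intro z hz
    have h3 : 0 < ‖f 0‖ := norm_pos_iff.2 hf0
    refine (hgr z).trans ?_
    nth_rw 1 [← Real.exp_log h3]
    rw [← Real.exp_add, Real.exp_le_exp, hz]
    have h4 : (1 + 3 * R) ^ (3 / 2 : ℝ) ≤ 4 ^ (3 / 2 : ℝ) * R ^ (3 / 2 : ℝ) := by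
      rw [← Real.mul_rpow (by norm_num) (by linarith)]
      exact Real.rpow_le_rpow (by linarith) (by linarith) (by norm_num)
    have h5 := neg_abs_le (Real.log ‖f 0‖)
    have h6 : |Real.log ‖f 0‖| ≤ |Real.log ‖f 0‖| * R ^ (3 / 2 : ℝ) :=
      le_mul_of_one_le_right (abs_nonneg _) hR1
    have h7 := mul_le_mul_of_nonneg_left h4 hC
    rw [hL, add_mul]
    linarith
  obtain ⟨h1, h2⟩ := sum_zeros_bounds hf (analyticOrderAt_ne_top_of_entire hf hf0) hf0
    (by linarith) hB hfin.toFinset (fun a ha ↦ ((hmem a).1 ha).1) (fun z h h' ↦ (hmem z).2 ⟨h, h'⟩)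
  refine ⟨hfin.toFinset, hmem, ?_, fun z hz hfz ↦ (h2 z hz hfz).trans ?_⟩
  · have h3 : 0 ≤ ∑ a ∈ hfin.toFinset, (analyticOrderNatAt f a : ℝ) := by positivity
    have h4 := mul_le_mul_of_nonneg_left hlog2 h3
    have h5 : 0 ≤ L * R ^ (3 / 2 : ℝ) := by positivity
    nlinarith
  · gcongr ?_ / _
    linarith

/-- The zeros of an entire function of growth `exp (O(|z|^(3/2)))` satisfy `∑ 1 / |ρ|² < ∞`. -/
lemma summable_zeros_div_one_add_norm_sq (hf : Differentiable ℂ f) (hf0 : f 0 ≠ 0) (hC : 0 ≤ C)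
    (hgr : ∀ z, ‖f z‖ ≤ Real.exp (C * (1 + ‖z‖) ^ (3 / 2 : ℝ))) :
    Summable fun a : ℂ ↦ (analyticOrderNatAt f a : ℝ) / (1 + ‖a‖) ^ 2 := by
  classical
  obtain ⟨K, hK, hZ⟩ := exists_zeros_bounds hf hf0 hC hgr
  set m := analyticOrderNatAt f with hm
  set q : ℝ := 2 ^ (3 / 2 : ℝ) with hq
  have hq0 : 0 < q := by positivity
  have hq4 : q / 4 < 1 := by
    have : q < 2 ^ (2 : ℝ) := Real.rpow_lt_rpow_of_exponent_lt (by norm_num) (by norm_num)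
    norm_num at this
    linarith
  have hgeo : Summable fun k : ℕ ↦ 4 * K * (q / 4) ^ k :=
    (summable_geometric_of_lt_one (by positivity) hq4).mul_left _
  have hk : ∀ a : ℂ, ∃ k : ℕ, ‖a‖ ≤ 2 ^ k ∧ (2 : ℝ) ^ k ≤ 2 * (1 + ‖a‖) := by
    intro a
    obtain ⟨k, hk1, hk2⟩ := exists_nat_pow_near (x := 1 + ‖a‖) (y := (2 : ℝ))
      (by linarith [norm_nonneg a]) (by norm_num)
    exact ⟨k + 1, by linarith, by rw [pow_succ]; linarith⟩
  choose k hk1 hk2 using hk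
  refine summable_of_sum_le (c := ∑' k : ℕ, 4 * K * (q / 4) ^ k) (fun a ↦ by positivity) fun T ↦ ?_
  set n : ℕ := T.sup k + 1 with hn
  calc ∑ a ∈ T, (m a : ℝ) / (1 + ‖a‖) ^ 2
      ≤ ∑ a ∈ T, ∑ j ∈ Finset.range n, if ‖a‖ ≤ 2 ^ j then 4 * m a / (4 : ℝ) ^ j else 0 := by
        refine Finset.sum_le_sum fun a ha ↦ ?_
        have hmem : k a ∈ Finset.range n := by
          rw [Finset.mem_range, hn, Nat.lt_succ_iff]; exact Finset.le_sup ha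
        refine le_trans ?_ (Finset.single_le_sum (f := fun j ↦
          if ‖a‖ ≤ 2 ^ j then 4 * (m a : ℝ) / (4 : ℝ) ^ j else 0) (fun j _ ↦ ?_) hmem)
        · simp only [hk1 a, if_true]
          rw [div_le_div_iff₀ (by positivity) (by positivity)]
          have h4 : (4 : ℝ) ^ k a = (2 ^ k a) ^ 2 := by
            rw [← pow_mul, mul_comm, pow_mul]; norm_num
          have h5 : (4 : ℝ) ^ k a ≤ 4 * (1 + ‖a‖) ^ 2 := by
            rw [h4]
            calc ((2 : ℝ) ^ k a) ^ 2 ≤ (2 * (1 + ‖a‖)) ^ 2 := by gcongr; exact hk2 a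
              _ = _ := by ring
          have := mul_le_mul_of_nonneg_left h5 (Nat.cast_nonneg (α := ℝ) (m a))
          linarith
        · split_ifs <;> positivity
    _ = ∑ j ∈ Finset.range n, ∑ a ∈ T, if ‖a‖ ≤ 2 ^ j then 4 * m a / (4 : ℝ) ^ j else 0 :=
        Finset.sum_comm
    _ ≤ ∑ j ∈ Finset.range n, 4 * K * (q / 4) ^ j := by
        refine Finset.sum_le_sum fun j _ ↦ ?_
        obtain ⟨Z, hZmem, hZc, -⟩ := hZ (2 ^ j) (one_le_pow₀ (by norm_num))
        have hqj : ((2 : ℝ) ^ j) ^ (3 / 2 : ℝ) = q ^ j := by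
          rw [hq, ← Real.rpow_natCast, ← Real.rpow_mul (by norm_num), mul_comm,
            Real.rpow_mul (by norm_num), Real.rpow_natCast]
        rw [hqj] at hZc
        have h1 : ∑ a ∈ T, (if ‖a‖ ≤ 2 ^ j then 4 * m a / (4 : ℝ) ^ j else 0) ≤
            ∑ a ∈ Z, 4 * m a / (4 : ℝ) ^ j := by
          rw [← Finset.sum_filter]
          rw [← Finset.sum_filter_ne_zero]
          refine Finset.sum_le_sum_of_subset_of_nonneg (fun a ha ↦ ?_) fun a _ _ ↦ by positivity
          obtain ⟨ha, hne⟩ := Finset.mem_filter.1 ha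
          rw [hZmem]
          refine ⟨(Finset.mem_filter.1 ha).2, ?_⟩
          refine apply_eq_zero_of_analyticOrderNatAt_ne_zero fun h0 ↦ hne ?_
          simp [hm, h0]
        refine h1.trans ?_
        rw [← Finset.sum_div, ← Finset.mul_sum, div_pow, ← mul_div_assoc]
        gcongr ?_ / _
        linarith
    _ ≤ _ := hgeo.sum_le_tsum _ fun j _ ↦ by positivity

open Filter Topology in
/-- **Hadamard**: for an entire function `f` of growth `exp (O(|z|^(3/2)))`, the second logarithmic
derivative is `-∑ 1 / (z - ρ)²`, the sum running over the zeros of `f` with multiplicity. -/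
theorem hasSum_zeros_deriv_logDeriv (hf : Differentiable ℂ f) (hf0 : f 0 ≠ 0) (hC : 0 ≤ C)
    (hgr : ∀ z, ‖f z‖ ≤ Real.exp (C * (1 + ‖z‖) ^ (3 / 2 : ℝ))) {z : ℂ} (hz : f z ≠ 0) :
    HasSum (fun a : ℂ ↦ (analyticOrderNatAt f a : ℂ) / (z - a) ^ 2) (-deriv (logDeriv f) z) := by
  classical
  have hsum := summable_zeros_div_one_add_norm_sq hf hf0 hC hgr
  obtain ⟨K, hK, hZ⟩ := exists_zeros_bounds hf hf0 hC hgr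
  set m := analyticOrderNatAt f with hm
  have hm0 : ∀ a, m a ≠ 0 → f a = 0 := fun a h ↦ apply_eq_zero_of_analyticOrderNatAt_ne_zero h
  obtain ⟨ε, hε, hball⟩ := Metric.eventually_nhds_iff.1
    (hf.continuous.continuousAt.eventually_ne hz)
  have hfar : ∀ a, m a ≠ 0 → ε ≤ ‖z - a‖ := by
    intro a ha
    by_contra! h
    exact hball (by rwa [dist_comm, dist_eq_norm]) (hm0 a ha)
  set D : ℝ := (1 + ‖z‖) / ε + 1 with hD
  have hD0 : 0 < D := by positivity
  have hbound : ∀ a, ‖(m a : ℂ) / (z - a) ^ 2‖ ≤ D ^ 2 * ((m a : ℝ) / (1 + ‖a‖) ^ 2) := by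
    intro a
    by_cases ha : m a = 0
    · simp [ha]
    have h1 := hfar a ha
    have h2 : 0 < ‖z - a‖ := hε.trans_le h1
    have h3 : ‖a‖ ≤ ‖z‖ + ‖z - a‖ := by
      have := norm_sub_le z (z - a); simpa using this
    have h4 : 1 + ‖z‖ ≤ (1 + ‖z‖) / ε * ‖z - a‖ := by
      rw [div_mul_eq_mul_div, le_div_iff₀ hε]; gcongr
    have h5 : 1 + ‖a‖ ≤ D * ‖z - a‖ := by rw [hD, add_mul]; linarith
    have h6 : (1 + ‖a‖) ^ 2 ≤ D ^ 2 * ‖z - a‖ ^ 2 := by rw [← mul_pow]; gcongr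
    rw [norm_div, norm_pow, norm_natCast, ← mul_div_assoc,
      div_le_div_iff₀ (by positivity) (by positivity)]
    have := mul_le_mul_of_nonneg_left h6 (Nat.cast_nonneg (α := ℝ) (m a))
    linarith
  have hS : Summable fun a ↦ (m a : ℂ) / (z - a) ^ 2 :=
    Summable.of_norm_bounded (hsum.mul_left _) hbound
  have hZ' : ∀ n : ℕ, ∃ Z : Finset ℂ, (∀ a, a ∈ Z ↔ ‖a‖ ≤ (n + 1 : ℝ) ∧ f a = 0) ∧
      (‖z‖ ≤ (n + 1 : ℝ) / 4 → ‖deriv (logDeriv f) z + ∑ a ∈ Z, (m a : ℂ) / (z - a) ^ 2‖ ≤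
          K * (n + 1 : ℝ) ^ (3 / 2 : ℝ) / (n + 1 : ℝ) ^ 2) := fun n ↦ by
    obtain ⟨Z, h1, -, h2⟩ := hZ (n + 1) (by simp)
    exact ⟨Z, h1, fun h ↦ h2 z h hz⟩
  choose Z hZmem hZb using hZ'
  have hlim1 : Tendsto (fun n ↦ ∑ a ∈ Z n, (m a : ℂ) / (z - a) ^ 2) atTop
      (𝓝 (∑' a, (m a : ℂ) / (z - a) ^ 2)) := by
    have h1 : ∀ n, ∑ a ∈ Z n, (m a : ℂ) / (z - a) ^ 2 =
        ∑' a, if a ∈ Z n then (m a : ℂ) / (z - a) ^ 2 else 0 := by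
      intro n
      rw [tsum_eq_sum (s := Z n)]
      · exact Finset.sum_congr rfl fun a ha ↦ by simp [ha]
      · intro a ha; simp [ha]
    simp_rw [h1]
    refine tendsto_tsum_of_dominated_convergence (hsum.mul_left (D ^ 2)) (fun a ↦ ?_)
      (Eventually.of_forall fun n a ↦ ?_)
    · by_cases ha : m a = 0
      · simp [ha]
      refine tendsto_const_nhds.congr' ?_
      filter_upwards [eventually_ge_atTop ⌈‖a‖⌉₊] with n hn
      rw [if_pos]
      rw [hZmem]
      refine ⟨?_, hm0 a ha⟩
      have h2 : (⌈‖a‖⌉₊ : ℝ) ≤ n := by exact_mod_cast hn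
      linarith [Nat.le_ceil ‖a‖]
    · split_ifs
      · exact hbound a
      · simp only [norm_zero]; positivity
  have hlim2 : Tendsto (fun n ↦ ∑ a ∈ Z n, (m a : ℂ) / (z - a) ^ 2) atTop
      (𝓝 (-deriv (logDeriv f) z)) := by
    rw [tendsto_iff_norm_sub_tendsto_zero]
    have hto : Tendsto (fun n : ℕ ↦ K * ((n + 1 : ℝ)) ^ (-(1 / 2) : ℝ)) atTop (𝓝 0) := by
      have h1 : Tendsto (fun n : ℕ ↦ (n + 1 : ℝ)) atTop atTop :=
        tendsto_atTop_add_const_right _ _ tendsto_natCast_atTop_atTop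
      simpa using ((tendsto_rpow_neg_atTop (y := 1 / 2) (by norm_num)).comp h1).const_mul K
    refine squeeze_zero' (Eventually.of_forall fun _ ↦ norm_nonneg _) ?_ hto
    filter_upwards [eventually_ge_atTop ⌈4 * ‖z‖⌉₊] with n hn
    have h2 : (⌈4 * ‖z‖⌉₊ : ℝ) ≤ n := by exact_mod_cast hn
    have h3 := hZb n (by linarith [Nat.le_ceil (4 * ‖z‖)])
    rw [sub_neg_eq_add, add_comm]
    refine h3.trans (le_of_eq ?_)
    rw [mul_div_assoc, ← Real.rpow_natCast, ← Real.rpow_sub (by positivity)]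
    norm_num
  rw [← tendsto_nhds_unique hlim1 hlim2]
  exact hS.hasSum

end ControlledGrowth

open MeasureTheory Set in
/-- A Mellin transform is bounded on any closed vertical strip with convergent boundary lines. -/
lemma exists_norm_mellin_le {f : ℝ → ℂ} {a b : ℝ} (ha : MellinConvergent f a)
    (hb : MellinConvergent f b) :
    ∃ K : ℝ, ∀ s : ℂ, a ≤ s.re → s.re ≤ b → ‖mellin f s‖ ≤ K := by
  refine ⟨∫ t in Ioi (0 : ℝ), (‖(t : ℂ) ^ ((a : ℂ) - 1) • f t‖ + ‖(t : ℂ) ^ ((b : ℂ) - 1) • f t‖),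
    fun s has hsb ↦ ?_⟩
  refine norm_integral_le_of_norm_le (ha.norm.add hb.norm) ?_
  filter_upwards [ae_restrict_mem measurableSet_Ioi] with t ht
  have ht : 0 < t := ht
  simp only [norm_smul, norm_cpow_eq_rpow_re_of_pos ht, sub_re, one_re, ofReal_re, ← add_mul]
  gcongr
  rcases le_total t 1 with h | h
  · have := Real.rpow_le_rpow_of_exponent_ge ht h (sub_le_sub_right has 1)
    linarith [Real.rpow_nonneg ht.le (b - 1)]
  · have := Real.rpow_le_rpow_of_exponent_le h (sub_le_sub_right hsb 1)
    linarith [Real.rpow_nonneg ht.le (a - 1)]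

lemma exists_norm_completedRiemannZeta₀_le (a b : ℝ) :
    ∃ K : ℝ, ∀ s : ℂ, a ≤ s.re → s.re ≤ b → ‖completedRiemannZeta₀ s‖ ≤ K := by
  have hconv (s : ℂ) : MellinConvergent (HurwitzZeta.hurwitzEvenFEPair 0).f_modif s :=
    ((HurwitzZeta.hurwitzEvenFEPair 0).isStrongFEPair_toStrongFEPair.hasMellin s).1
  obtain ⟨K, hK⟩ := exists_norm_mellin_le (hconv (a / 2 : ℝ)) (hconv (b / 2 : ℝ))
  refine ⟨K / 2, fun s has hsb ↦ ?_⟩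
  have hre : (s / 2).re = s.re / 2 := by simp
  have h := hK (s / 2) (by rw [hre]; linarith) (by rw [hre]; linarith)
  rw [← HurwitzZeta.completedHurwitzZetaEven₀_zero, HurwitzZeta.completedHurwitzZetaEven₀,
    WeakFEPair.Λ₀, norm_div, Complex.norm_ofNat]
  linarith

lemma Real.Gamma_le_exp_rpow {x : ℝ} (hx : 1 ≤ x) :
    Real.Gamma x ≤ Real.exp (2 * (1 + x) ^ (3 / 2 : ℝ)) := by
  set n : ℕ := ⌈x⌉₊ with hn
  have hn1 : x ≤ n := Nat.le_ceil x
  have hn2 : (n : ℝ) < x + 1 := Nat.ceil_lt_add_one (by linarith)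
  have hn0 : (0 : ℝ) < n := by linarith
  have h1 : Real.Gamma x ≤ Real.Gamma (x + 1) := by
    rw [Real.Gamma_add_one (by linarith)]
    exact le_mul_of_one_le_left (Real.Gamma_pos_of_pos (by linarith)).le hx
  have h2 : Real.Gamma (x + 1) ≤ Real.Gamma (n + 1) :=
    Real.Gamma_strictMonoOn_Ici.monotoneOn (by simp; linarith) (by simp; linarith) (by linarith)
  have h3 : (n.factorial : ℝ) ≤ Real.exp (n * Real.log n) := by
    rw [mul_comm, ← Real.rpow_def_of_pos hn0, Real.rpow_natCast]
    exact_mod_cast Nat.factorial_le_pow n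
  have h4 : Real.log n ≤ 2 * (n : ℝ) ^ (1 / 2 : ℝ) := by
    have := Real.log_le_rpow_div hn0.le (ε := 1 / 2) (by norm_num)
    linarith
  rw [Real.Gamma_nat_eq_factorial] at h2
  refine (h1.trans (h2.trans h3)).trans (Real.exp_le_exp.2 ?_)
  calc (n : ℝ) * Real.log n ≤ n * (2 * (n : ℝ) ^ (1 / 2 : ℝ)) := by gcongr
    _ = 2 * (n : ℝ) ^ (3 / 2 : ℝ) := by
      rw [show (3 / 2 : ℝ) = 1 + 1 / 2 by norm_num, Real.rpow_add hn0, Real.rpow_one]; ring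
    _ ≤ _ := by gcongr; linarith

lemma Complex.norm_Gamma_le {s : ℂ} (hs : 0 < s.re) : ‖Gamma s‖ ≤ Real.Gamma s.re := by
  rw [Gamma_eq_integral hs, Real.Gamma_eq_integral hs]
  refine MeasureTheory.norm_integral_le_of_norm_le (Real.GammaIntegral_convergent hs) ?_
  filter_upwards [MeasureTheory.ae_restrict_mem measurableSet_Ioi] with t ht
  have ht : 0 < t := ht
  simp [norm_cpow_eq_rpow_re_of_pos ht, Complex.norm_exp]

lemma Complex.norm_sin_le (z : ℂ) : ‖sin z‖ ≤ Real.exp ‖z‖ := by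
  have h1 : ‖cexp (-z * I)‖ ≤ Real.exp ‖z‖ := by
    refine (norm_exp_le_exp_norm _).trans (Real.exp_le_exp.2 ?_); simp
  have h2 : ‖cexp (z * I)‖ ≤ Real.exp ‖z‖ := by
    refine (norm_exp_le_exp_norm _).trans (Real.exp_le_exp.2 ?_); simp
  rw [sin, norm_div, norm_mul, norm_I, mul_one, Complex.norm_ofNat]
  have := norm_sub_le (cexp (-z * I)) (cexp (z * I))
  linarith

lemma Complex.norm_cos_le (z : ℂ) : ‖cos z‖ ≤ Real.exp ‖z‖ := by
  have h1 : ‖cexp (-z * I)‖ ≤ Real.exp ‖z‖ := by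
    refine (norm_exp_le_exp_norm _).trans (Real.exp_le_exp.2 ?_); simp
  have h2 : ‖cexp (z * I)‖ ≤ Real.exp ‖z‖ := by
    refine (norm_exp_le_exp_norm _).trans (Real.exp_le_exp.2 ?_); simp
  rw [cos, norm_div, Complex.norm_ofNat]
  have := norm_add_le (cexp (z * I)) (cexp (-z * I))
  linarith

/-- Bound for `1 / Γ` in the strip `1 ≤ Re s ≤ 2`. -/
lemma exists_norm_inv_Gamma_le :
    ∃ K : ℝ, ∀ s : ℂ, 1 ≤ s.re → s.re ≤ 2 → ‖(Gamma s)⁻¹‖ ≤ Real.exp (K + 4 * ‖s‖) := by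
  have hcont : Continuous fun s : ℂ ↦ (Gamma s)⁻¹ := differentiable_one_div_Gamma.continuous
  obtain ⟨K₀, hK₀⟩ := (isCompact_closedBall (0 : ℂ) 3).exists_bound_of_continuousOn
    hcont.continuousOn
  set G : ℝ := 2 * 3 ^ (3 / 2 : ℝ) with hG
  refine ⟨max K₀ (G + 4), fun s hs1 hs2 ↦ ?_⟩
  rcases le_total ‖s‖ 3 with h | h
  · refine (hK₀ s (by simpa using h)).trans ?_
    have h1 := Real.add_one_le_exp (max K₀ (G + 4) + 4 * ‖s‖)
    linarith [le_max_left K₀ (G + 4), norm_nonneg s]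
  · have him : 1 ≤ |s.im| := by
      have := Complex.norm_le_abs_re_add_abs_im s
      rw [abs_of_nonneg (by linarith)] at this
      linarith
    have hA : 1 ≤ ‖s - 1‖ := him.trans (by simpa using abs_im_le_norm (s - 1))
    have hB : 1 ≤ ‖2 - s‖ := him.trans (by simpa using abs_im_le_norm (2 - s))
    have hA0 : s - 1 ≠ 0 := norm_pos_iff.1 (by linarith)
    have hB0 : 2 - s ≠ 0 := norm_pos_iff.1 (by linarith)
    have hG1 : Gamma s = (s - 1) * Gamma (s - 1) := by
      have := Gamma_add_one (s - 1) hA0; simpa using this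
    have hG2 : Gamma (3 - s) = (2 - s) * Gamma (2 - s) := by
      have := Gamma_add_one (2 - s) hB0
      rwa [show 2 - s + 1 = 3 - s by ring] at this
    have hrefl := Gamma_mul_Gamma_one_sub (s - 1)
    rw [show 1 - (s - 1) = 2 - s by ring] at hrefl
    have hGs : Gamma s ≠ 0 := Gamma_ne_zero_of_re_pos (by linarith)
    have hG3 : Gamma (2 - s) ≠ 0 := by
      intro h0
      have : Gamma (3 - s) = 0 := by rw [hG2, h0, mul_zero]
      exact Gamma_ne_zero_of_re_pos (by simp; linarith) this
    have hG4 : Gamma (s - 1) ≠ 0 := fun h0 ↦ hGs (by rw [hG1, h0, mul_zero])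
    have hsin : sin (Real.pi * (s - 1)) ≠ 0 := by
      intro h0
      rw [h0, div_zero] at hrefl
      exact mul_ne_zero hG4 hG3 hrefl
    have hpi : (Real.pi : ℂ) ≠ 0 := by exact_mod_cast Real.pi_ne_zero
    have hkey : (Gamma s)⁻¹ = Gamma (3 - s) * sin (Real.pi * (s - 1)) /
        (Real.pi * (s - 1) * (2 - s)) := by
      rw [hG1, hG2]
      rw [eq_div_iff hsin] at hrefl
      generalize sin (Real.pi * (s - 1)) = S at *
      field_simp
      linear_combination -hrefl
    have h1 : ‖Gamma (3 - s)‖ ≤ Real.exp G := by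
      have hre : (3 - s).re = 3 - s.re := by simp
      refine (norm_Gamma_le (by rw [hre]; linarith)).trans
        ((Real.Gamma_le_exp_rpow (by rw [hre]; linarith)).trans (Real.exp_le_exp.2 ?_))
      rw [hG, hre]
      gcongr <;> linarith
    have h2 : ‖sin (Real.pi * (s - 1))‖ ≤ Real.exp (4 * ‖s‖ + 4) := by
      refine (norm_sin_le _).trans (Real.exp_le_exp.2 ?_)
      rw [norm_mul, norm_real, Real.norm_of_nonneg Real.pi_pos.le]
      have : ‖s - 1‖ ≤ ‖s‖ + 1 := by simpa using norm_sub_le s 1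
      nlinarith [Real.pi_lt_four, Real.pi_pos, norm_nonneg s]
    have h3 : 1 ≤ ‖(Real.pi : ℂ) * (s - 1) * (2 - s)‖ := by
      rw [norm_mul, norm_mul, norm_real, Real.norm_of_nonneg Real.pi_pos.le]
      exact one_le_mul_of_one_le_of_one_le
        (one_le_mul_of_one_le_of_one_le (by linarith [Real.pi_gt_three]) hA) hB
    rw [hkey, norm_div, norm_mul]
    refine (div_le_self (by positivity) h3).trans ?_
    calc ‖Gamma (3 - s)‖ * ‖sin (Real.pi * (s - 1))‖
        ≤ Real.exp G * Real.exp (4 * ‖s‖ + 4) := by gcongr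
      _ = Real.exp (G + 4 + 4 * ‖s‖) := by rw [← Real.exp_add]; ring_nf
      _ ≤ _ := by gcongr; exact le_max_right _ _

lemma riemannZeta₁_eq_sub_mul {s : ℂ} (hs : s ≠ 1) : riemannZeta₁ s = (s - 1) * riemannZeta s := by
  rw [riemannZeta_eq_inv_sub_mul hs, mul_inv_cancel_left₀ (sub_ne_zero.2 hs)]

lemma Real.two_mul_rpow_three_halves_le {x : ℝ} (hx : 0 ≤ x) :
    (2 * x) ^ (3 / 2 : ℝ) ≤ 3 * x ^ (3 / 2 : ℝ) := by
  have h : (2 : ℝ) ^ (3 / 2 : ℝ) ≤ 3 := by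
    have h' : ((2 : ℝ) ^ (3 / 2 : ℝ)) ^ 2 = 8 := by
      rw [← Real.rpow_natCast, ← Real.rpow_mul (by norm_num)]; norm_num
    nlinarith [Real.rpow_nonneg (zero_le_two (α := ℝ)) (3 / 2)]
  rw [Real.mul_rpow (by norm_num) hx]
  gcongr

/-- Bound for `(s - 1) ζ(s)` to the right of the critical strip. -/
lemma exists_norm_riemannZeta₁_le_of_two_le_re :
    ∃ C : ℝ, ∀ s : ℂ, 2 ≤ s.re → ‖riemannZeta₁ s‖ ≤ Real.exp (C * (1 + ‖s‖)) := by
  have hsum : Summable fun n : ℕ ↦ 1 / (n : ℝ) ^ 2 := Real.summable_one_div_nat_pow.2 (by norm_num)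
  refine ⟨1 + ∑' n : ℕ, 1 / (n : ℝ) ^ 2, fun s hs ↦ ?_⟩
  have hS : 0 ≤ ∑' n : ℕ, 1 / (n : ℝ) ^ 2 := tsum_nonneg fun n ↦ by positivity
  have hs1 : s ≠ 1 := by rintro rfl; norm_num at hs
  have hz : ‖riemannZeta s‖ ≤ ∑' n : ℕ, 1 / (n : ℝ) ^ 2 := by
    rw [zeta_eq_tsum_one_div_nat_cpow (by linarith)]
    refine tsum_of_norm_bounded hsum.hasSum fun n ↦ ?_
    rcases n.eq_zero_or_pos with rfl | hn
    · have : s ≠ 0 := by rintro rfl; norm_num at hs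
      simp [zero_cpow this]
    · rw [norm_div, norm_one, norm_natCast_cpow_of_pos hn, ← Real.rpow_natCast]
      gcongr
      · exact_mod_cast hn
      · exact_mod_cast hs
  have h1 : ‖s - 1‖ ≤ 1 + ‖s‖ := by simpa [add_comm] using norm_sub_le s 1
  rw [riemannZeta₁_eq_sub_mul hs1, norm_mul]
  calc ‖s - 1‖ * ‖riemannZeta s‖ ≤ (1 + ‖s‖) * ∑' n : ℕ, 1 / (n : ℝ) ^ 2 := by gcongr
    _ ≤ (1 + ∑' n : ℕ, 1 / (n : ℝ) ^ 2) * (1 + ‖s‖) := by nlinarith [norm_nonneg s]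
    _ ≤ _ := by linarith [Real.add_one_le_exp ((1 + ∑' n : ℕ, 1 / (n : ℝ) ^ 2) * (1 + ‖s‖))]

/-- Bound for `(s - 1) ζ(s)` in the strip `1 / 2 ≤ Re s ≤ 2`. -/
lemma exists_norm_riemannZeta₁_le_of_re_le_two :
    ∃ C : ℝ, ∀ s : ℂ, 1 / 2 ≤ s.re → s.re ≤ 2 →
      ‖riemannZeta₁ s‖ ≤ Real.exp (C * (1 + ‖s‖)) := by
  obtain ⟨K, hK⟩ := exists_norm_completedRiemannZeta₀_le (1 / 2) 2
  obtain ⟨L, hL⟩ := exists_norm_inv_Gamma_le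
  have hK0 : 0 ≤ K := (norm_nonneg _).trans (hK 1 (by norm_num) (by norm_num))
  refine ⟨(K + 2) + 4 + (|L| + 8), fun s hs1 hs2 ↦ ?_⟩
  have hs0 : s ≠ 0 := by rintro rfl; norm_num at hs1
  rcases eq_or_ne s 1 with rfl | hs
  · rw [riemannZeta₁_one, norm_one]; exact Real.one_le_exp (by positivity)
  have hn : 0 ≤ ‖s‖ := norm_nonneg s
  have h1 : ‖s - 1‖ ≤ 1 + ‖s‖ := by simpa [add_comm] using norm_sub_le s 1
  have hre : (s / 2 + 1).re = s.re / 2 + 1 := by simp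
  have hinv := hL (s / 2 + 1) (by rw [hre]; linarith) (by rw [hre]; linarith)
  have hpi : (Real.pi : ℂ) ≠ 0 := by exact_mod_cast Real.pi_ne_zero
  have heq : riemannZeta₁ s = ((s - 1) * s * completedRiemannZeta₀ s + 1) *
      (Real.pi : ℂ) ^ (s / 2) * (Gamma (s / 2 + 1))⁻¹ / 2 := by
    rw [riemannZeta₁_eq_sub_mul hs, riemannZeta_eq_mul_completedRiemannZeta₀]
    have : 1 - s ≠ 0 := sub_ne_zero.2 hs.symm
    have hG : Gamma (s / 2 + 1) ≠ 0 := Gamma_ne_zero_of_re_pos (by rw [hre]; linarith)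
    have hp : (Real.pi : ℂ) ^ (s / 2) ≠ 0 := by simp [cpow_eq_zero_iff, hpi]
    rw [neg_div, cpow_neg]
    field_simp
    ring
  have hA : ‖(s - 1) * s * completedRiemannZeta₀ s + 1‖ ≤ Real.exp ((K + 2) * (1 + ‖s‖)) := by
    calc _ ≤ ‖s - 1‖ * ‖s‖ * ‖completedRiemannZeta₀ s‖ + 1 := by
          refine (norm_add_le _ _).trans ?_
          rw [norm_mul, norm_mul, norm_one]
      _ ≤ (1 + ‖s‖) * (1 + ‖s‖) * K + 1 := by
          gcongr
          · linarith
          · exact hK s hs1 hs2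
      _ ≤ (K + 1) * (1 + ‖s‖) ^ 2 := by nlinarith
      _ ≤ Real.exp K * Real.exp ‖s‖ ^ 2 := by
          gcongr
          · exact Real.add_one_le_exp K
          · linarith [Real.add_one_le_exp ‖s‖]
      _ = Real.exp (K + 2 * ‖s‖) := by rw [← Real.exp_nat_mul, ← Real.exp_add]; norm_num
      _ ≤ _ := by gcongr; nlinarith
  have hB : ‖(Real.pi : ℂ) ^ (s / 2)‖ ≤ Real.exp (4 * (1 + ‖s‖)) := by
    rw [norm_cpow_eq_rpow_re_of_pos Real.pi_pos]
    calc Real.pi ^ (s / 2).re ≤ Real.pi ^ (1 : ℝ) :=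
          Real.rpow_le_rpow_of_exponent_le (by linarith [Real.pi_gt_three]) (by simp; linarith)
      _ ≤ 4 * (1 + ‖s‖) := by rw [Real.rpow_one]; linarith [Real.pi_lt_four]
      _ ≤ _ := by linarith [Real.add_one_le_exp (4 * (1 + ‖s‖))]
  have hD : ‖(Gamma (s / 2 + 1))⁻¹‖ ≤ Real.exp ((|L| + 8) * (1 + ‖s‖)) := by
    refine hinv.trans (Real.exp_le_exp.2 ?_)
    have : ‖s / 2 + 1‖ ≤ ‖s‖ / 2 + 1 := by simpa using norm_add_le (s / 2) 1
    nlinarith [le_abs_self L, abs_nonneg L]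
  rw [heq, norm_div, norm_mul, norm_mul, add_mul, add_mul, Real.exp_add, Real.exp_add,
    Complex.norm_ofNat]
  refine (div_le_self (by positivity) (by norm_num)).trans ?_
  gcongr

/-- Bound for `(s - 1) ζ(s)` to the left of the critical line. -/
lemma exists_norm_riemannZeta₁_one_sub_le {C₀ : ℝ}
    (hC₀ : ∀ s : ℂ, 1 / 2 ≤ s.re → ‖riemannZeta₁ s‖ ≤ Real.exp (C₀ * (1 + ‖s‖))) :
    ∃ C : ℝ, ∀ s : ℂ, 1 / 2 ≤ s.re →
      ‖riemannZeta₁ (1 - s)‖ ≤ Real.exp (C * (1 + ‖s‖) ^ (3 / 2 : ℝ)) := by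
  obtain ⟨K, hK⟩ := (isCompact_closedBall (1 : ℂ) 1).exists_bound_of_continuousOn
    (f := fun s ↦ riemannZeta₁ (1 - s))
    (differentiable_riemannZeta₁.continuous.comp (by fun_prop)).continuousOn
  have hK0 : 0 ≤ K := (norm_nonneg _).trans (hK 1 (by simp))
  refine ⟨K + (2 + 2 + 6 + 2 + |C₀|), fun s hs ↦ ?_⟩
  have hn : 0 ≤ ‖s‖ := norm_nonneg s
  have hpow1 : 1 + ‖s‖ ≤ (1 + ‖s‖) ^ (3 / 2 : ℝ) :=
    Real.self_le_rpow_of_one_le (by linarith) (by norm_num)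
  rcases le_total ‖s - 1‖ 1 with h | h
  · refine (hK s (by simpa [dist_eq_norm] using h)).trans ?_
    have := Real.add_one_le_exp ((K + (2 + 2 + 6 + 2 + |C₀|)) * (1 + ‖s‖) ^ (3 / 2 : ℝ))
    nlinarith [abs_nonneg C₀]
  have hs1 : s ≠ 1 := by rintro rfl; norm_num at h
  have hs0 : s ≠ 0 := by rintro rfl; norm_num at hs
  have hsn (n : ℕ) : s ≠ -n := by
    rintro rfl
    have : (0 : ℝ) ≤ n := n.cast_nonneg
    simp at hs; linarith
  have heq : riemannZeta₁ (1 - s) = -s * (2 * (2 * Real.pi) ^ (-s) * Gamma s *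
      cos (Real.pi * s / 2) * (riemannZeta₁ s / (s - 1))) := by
    rw [riemannZeta₁_eq_sub_mul (s := 1 - s) (by simpa using hs0), riemannZeta_one_sub hsn hs1,
      riemannZeta_eq_inv_sub_mul hs1]
    ring
  set P : ℝ := (1 + ‖s‖) ^ (3 / 2 : ℝ)
  have hP0 : 1 ≤ P := by linarith
  have h1 : ‖-s‖ * 2 ≤ Real.exp (2 * P) := by
    rw [norm_neg]; linarith [Real.add_one_le_exp (2 * P)]
  have h2 : ‖(2 * Real.pi : ℂ) ^ (-s)‖ ≤ 1 := by
    have : (2 * Real.pi : ℂ) = ((2 * Real.pi : ℝ) : ℂ) := by push_cast; rfl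
    rw [this, norm_cpow_eq_rpow_re_of_pos (by positivity)]
    exact Real.rpow_le_one_of_one_le_of_nonpos (by linarith [Real.pi_gt_three])
      (by simp; linarith)
  have h3 : ‖Gamma s‖ ≤ Real.exp (2 * P) * Real.exp (6 * P) := by
    have hσ : s.re ≤ ‖s‖ := re_le_norm s
    have hG : Real.Gamma s.re ≤ 2 * Real.Gamma (s.re + 1) := by
      rw [Real.Gamma_add_one (by linarith)]
      nlinarith [Real.Gamma_pos_of_pos (by linarith : 0 < s.re)]
    have hG' : Real.Gamma (s.re + 1) ≤ Real.exp (6 * P) := by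
      refine (Real.Gamma_le_exp_rpow (by linarith)).trans (Real.exp_le_exp.2 ?_)
      calc 2 * (1 + (s.re + 1)) ^ (3 / 2 : ℝ) ≤ 2 * (2 * (1 + ‖s‖)) ^ (3 / 2 : ℝ) := by
            gcongr; linarith
        _ ≤ 2 * (3 * P) := by
            gcongr; exact Real.two_mul_rpow_three_halves_le (by linarith)
        _ = 6 * P := by ring
    calc ‖Gamma s‖ ≤ 2 * Real.Gamma (s.re + 1) := (norm_Gamma_le (by linarith)).trans hG
      _ ≤ Real.exp (2 * P) * Real.exp (6 * P) := by
          gcongr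
          linarith [Real.add_one_le_exp (2 * P)]
  have h4 : ‖cos (Real.pi * s / 2)‖ ≤ Real.exp (2 * P) := by
    refine (norm_cos_le _).trans (Real.exp_le_exp.2 ?_)
    rw [norm_div, norm_mul, norm_real, Real.norm_of_nonneg Real.pi_pos.le, Complex.norm_ofNat]
    nlinarith [Real.pi_lt_four, Real.pi_pos]
  have h5 : ‖riemannZeta₁ s / (s - 1)‖ ≤ Real.exp (|C₀| * P) := by
    rw [norm_div]
    refine (div_le_self (norm_nonneg _) h).trans ((hC₀ s hs).trans (Real.exp_le_exp.2 ?_))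
    nlinarith [le_abs_self C₀, abs_nonneg C₀]
  calc ‖riemannZeta₁ (1 - s)‖ = (‖-s‖ * 2) * ‖(2 * Real.pi : ℂ) ^ (-s)‖ * ‖Gamma s‖ *
        ‖cos (Real.pi * s / 2)‖ * ‖riemannZeta₁ s / (s - 1)‖ := by
        rw [heq, norm_mul, norm_mul, norm_mul, norm_mul, norm_mul, Complex.norm_ofNat]; ring
    _ ≤ Real.exp (2 * P) * 1 * (Real.exp (2 * P) * Real.exp (6 * P)) * Real.exp (2 * P) *
        Real.exp (|C₀| * P) := by gcongr
    _ = Real.exp ((2 + 2 + 6 + 2 + |C₀|) * P) := by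
        rw [mul_one]; simp only [← Real.exp_add]; ring_nf
    _ ≤ _ := Real.exp_le_exp.2 (by nlinarith)

theorem exists_norm_riemannZeta₁_le :
    ∃ C : ℝ, 0 ≤ C ∧ ∀ s : ℂ, ‖riemannZeta₁ s‖ ≤ Real.exp (C * (1 + ‖s‖) ^ (3 / 2 : ℝ)) := by
  obtain ⟨C₁, h₁⟩ := exists_norm_riemannZeta₁_le_of_two_le_re
  obtain ⟨C₂, h₂⟩ := exists_norm_riemannZeta₁_le_of_re_le_two
  have h₀ (s : ℂ) (hs : 1 / 2 ≤ s.re) :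
      ‖riemannZeta₁ s‖ ≤ Real.exp ((max C₁ C₂) * (1 + ‖s‖)) := by
    rcases le_total s.re 2 with h | h
    · exact (h₂ s hs h).trans (by gcongr; exact le_max_right _ _)
    · exact (h₁ s h).trans (by gcongr; exact le_max_left _ _)
  obtain ⟨C₃, h₃⟩ := exists_norm_riemannZeta₁_one_sub_le h₀
  refine ⟨|max C₁ C₂| + |C₃| * 3, by positivity, fun s ↦ ?_⟩
  have hn : 0 ≤ ‖s‖ := norm_nonneg s
  have hpow1 : 1 + ‖s‖ ≤ (1 + ‖s‖) ^ (3 / 2 : ℝ) :=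
    Real.self_le_rpow_of_one_le (by linarith) (by norm_num)
  rcases le_total (1 / 2) s.re with h | h
  · refine (h₀ s h).trans (Real.exp_le_exp.2 ?_)
    nlinarith [le_abs_self (max C₁ C₂), abs_nonneg (max C₁ C₂), abs_nonneg C₃]
  · have := h₃ (1 - s) (by simp; linarith)
    rw [sub_sub_cancel] at this
    refine this.trans (Real.exp_le_exp.2 ?_)
    have h4 : (1 + ‖1 - s‖) ^ (3 / 2 : ℝ) ≤ 3 * (1 + ‖s‖) ^ (3 / 2 : ℝ) := by
      have h5 : 1 + ‖1 - s‖ ≤ 2 * (1 + ‖s‖) := by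
        have := norm_sub_le 1 s
        rw [norm_one] at this; linarith
      exact (by gcongr : _ ≤ (2 * (1 + ‖s‖)) ^ (3 / 2 : ℝ)).trans
        (Real.two_mul_rpow_three_halves_le (by linarith))
    calc C₃ * (1 + ‖1 - s‖) ^ (3 / 2 : ℝ) ≤ |C₃| * (3 * (1 + ‖s‖) ^ (3 / 2 : ℝ)) := by
          gcongr
          exact le_abs_self _
      _ ≤ _ := by nlinarith [abs_nonneg (max C₁ C₂)]

lemma zeroMult_eq_analyticOrderNatAt {f : ℂ → ℂ} {ρ : ℂ} (hf : AnalyticAt ℂ f ρ)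
    (h : analyticOrderAt f ρ ≠ ⊤) : zeroMult f ρ = analyticOrderNatAt f ρ := by
  have hset : {n : ℕ | ∃ g : ℂ → ℂ, AnalyticAt ℂ g ρ ∧
      ∀ᶠ z in nhds ρ, f z = (z - ρ) ^ n * g z} = Set.Iic (analyticOrderNatAt f ρ) := by
    ext n
    rw [Set.mem_ofPred_eq, Set.mem_Iic, ← Nat.cast_le (α := ℕ∞), Nat.cast_analyticOrderNatAt h,
      natCast_le_analyticOrderAt hf]
    simp only [smul_eq_mul]
  rw [zeroMult, hset, csSup_Iic]

open Filter Topology in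
lemma zeroMult_riemannZeta_one : zeroMult riemannZeta 1 = 0 := by
  have hset : {n : ℕ | ∃ g : ℂ → ℂ, AnalyticAt ℂ g 1 ∧
      ∀ᶠ z in nhds 1, riemannZeta z = (z - 1) ^ n * g z} = ∅ := by
    refine Set.eq_empty_iff_forall_notMem.2 fun n ⟨g, hg, hgz⟩ ↦ ?_
    have h1 : Tendsto (fun z : ℂ ↦ (z - 1) * ((z - 1) ^ n * g z)) (𝓝[≠] 1) (𝓝 0) := by
      have : ContinuousAt (fun z : ℂ ↦ (z - 1) * ((z - 1) ^ n * g z)) 1 := by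
        have := hg.continuousAt
        fun_prop
      have h := this.tendsto
      simp only [sub_self, zero_mul] at h
      exact h.mono_left nhdsWithin_le_nhds
    have h2 : Tendsto (fun z : ℂ ↦ (z - 1) * ((z - 1) ^ n * g z)) (𝓝[≠] 1) (𝓝 1) := by
      refine riemannZeta_residue_one.congr' ?_
      filter_upwards [hgz.filter_mono nhdsWithin_le_nhds] with z hz
      rw [hz]
    exact zero_ne_one (tendsto_nhds_unique h1 h2)
  rw [zeroMult, hset, csSup_empty, bot_eq_zero]

lemma riemannZeta₁_zero : riemannZeta₁ 0 = 1 / 2 := by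
  rw [riemannZeta₁_eq_sub_mul zero_ne_one, riemannZeta_zero]; norm_num

lemma zeroMult_riemannZeta (ρ : ℂ) :
    zeroMult riemannZeta ρ = analyticOrderNatAt riemannZeta₁ ρ := by
  have han : AnalyticAt ℂ riemannZeta₁ ρ := differentiable_riemannZeta₁.analyticAt ρ
  have htop : analyticOrderAt riemannZeta₁ ρ ≠ ⊤ :=
    analyticOrderAt_ne_top_of_entire differentiable_riemannZeta₁ (w := 1) (by simp) ρ
  rcases eq_or_ne ρ 1 with rfl | hρ
  · rw [zeroMult_riemannZeta_one, analyticOrderNatAt,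
      han.analyticOrderAt_eq_zero.2 (by simp), ENat.toNat_zero]
  have hev : riemannZeta =ᶠ[nhds ρ] (fun s ↦ (s - 1)⁻¹) * riemannZeta₁ := by
    filter_upwards [isOpen_ne.mem_nhds hρ] with s hs using riemannZeta_eq_inv_sub_mul hs
  have hinv : AnalyticAt ℂ (fun s : ℂ ↦ (s - 1)⁻¹) ρ :=
    (analyticAt_id.sub analyticAt_const).inv (sub_ne_zero.2 hρ)
  have hord : analyticOrderAt riemannZeta ρ = analyticOrderAt riemannZeta₁ ρ := by
    rw [analyticOrderAt_congr hev, analyticOrderAt_mul hinv han,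
      hinv.analyticOrderAt_eq_zero.2 (inv_ne_zero (sub_ne_zero.2 hρ)), zero_add]
  rw [zeroMult_eq_analyticOrderNatAt ((hinv.mul han).congr hev.symm) (hord ▸ htop),
    analyticOrderNatAt, analyticOrderNatAt, hord]

/-- The partial fraction expansion of the derivative of the logarithmic derivative of `ζ`. -/
theorem deriv_logDeriv_riemannZeta {w : ℂ} (hw : 1 < w.re) :
    deriv (logDeriv riemannZeta) w =
      1 / (w - 1) ^ 2 - ∑' ρ : ℂ, (zeroMult riemannZeta ρ : ℂ) / (w - ρ) ^ 2 := by
  obtain ⟨C, hC, hgr⟩ := exists_norm_riemannZeta₁_le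
  have hne (z : ℂ) (hz : 1 < z.re) : z ≠ 1 := by rintro rfl; norm_num at hz
  have hz1 (z : ℂ) (hz : 1 < z.re) : riemannZeta₁ z ≠ 0 := by
    rw [riemannZeta₁_eq_sub_mul (hne z hz)]
    exact mul_ne_zero (sub_ne_zero.2 (hne z hz)) (riemannZeta_ne_zero_of_one_le_re hz.le)
  have hsum := hasSum_zeros_deriv_logDeriv differentiable_riemannZeta₁
    (by rw [riemannZeta₁_zero]; norm_num) hC hgr (hz1 w hw)
  simp only [zeroMult_riemannZeta]
  rw [hsum.tsum_eq, sub_neg_eq_add]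
  have hopen : {z : ℂ | 1 < z.re} ∈ nhds w := (isOpen_lt continuous_const continuous_re).mem_nhds hw
  have hev : logDeriv riemannZeta =ᶠ[nhds w]
      fun z ↦ -(z - 1)⁻¹ + logDeriv riemannZeta₁ z := by
    filter_upwards [hopen] with z hz
    have hz0 : z - 1 ≠ 0 := sub_ne_zero.2 (hne z hz)
    have hloc : riemannZeta =ᶠ[nhds z] fun s ↦ (s - 1)⁻¹ * riemannZeta₁ s := by
      filter_upwards [isOpen_ne.mem_nhds (hne z hz)] with s hs using riemannZeta_eq_inv_sub_mul hs
    have hd : HasDerivAt (fun s : ℂ ↦ (s - 1)⁻¹) (-1 / (z - 1) ^ 2) z :=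
      ((hasDerivAt_id z).sub_const 1).inv hz0
    rw [logDeriv_apply, hloc.deriv_eq, hloc.eq_of_nhds, ← logDeriv_apply,
      logDeriv_mul (f := fun s ↦ (s - 1)⁻¹) z (inv_ne_zero hz0) (hz1 z hz) hd.differentiableAt
        differentiable_riemannZeta₁.differentiableAt, logDeriv_apply, hd.deriv]
    congr 1
    field_simp
  have hw0 : w - 1 ≠ 0 := sub_ne_zero.2 (hne w hw)
  have hd : HasDerivAt (fun s : ℂ ↦ -(s - 1)⁻¹) (-(-1 / (w - 1) ^ 2)) w :=
    (((hasDerivAt_id w).sub_const 1).inv hw0).neg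
  have hld : DifferentiableAt ℂ (logDeriv riemannZeta₁) w :=
    (((differentiable_riemannZeta₁.analyticAt w).deriv).differentiableAt.div
      differentiable_riemannZeta₁.differentiableAt (hz1 w hw))
  rw [hev.deriv_eq, deriv_fun_add hd.differentiableAt hld, hd.deriv]
  ring

lemma Nat.rad_le {m : ℕ} (hm : m ≠ 0) : m.rad ≤ m :=
  Nat.le_of_dvd (Nat.pos_of_ne_zero hm) (Nat.prod_primeFactors_dvd m)

lemma Nat.Coprime.rad_mul {m n : ℕ} (h : m.Coprime n) : (m * n).rad = m.rad * n.rad := by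
  rw [Nat.rad, h.primeFactors_mul, Finset.prod_union h.disjoint_primeFactors, Nat.rad, Nat.rad]

lemma Nat.Prime.rad_pow {p : ℕ} (hp : p.Prime) (k : ℕ) : (p ^ (k + 1)).rad = p := by
  rw [Nat.rad, Nat.primeFactors_prime_pow k.succ_ne_zero hp, Finset.prod_singleton]

lemma bcoef_one : bcoef 1 = 1 := by simp [bcoef, Nat.rad]

lemma bcoef_prime_pow {p : ℕ} (hp : p.Prime) (k : ℕ) : bcoef (p ^ (k + 1)) = 1 - p := by
  rw [bcoef, hp.rad_pow, ArithmeticFunction.moebius_apply_prime hp, Nat.totient_prime hp,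
    Nat.cast_sub hp.one_le]
  push_cast
  ring

lemma bcoef_mul {m n : ℕ} (h : m.Coprime n) : bcoef (m * n) = bcoef m * bcoef n := by
  have hrad : m.rad.Coprime n.rad :=
    (h.coprime_dvd_left (Nat.prod_primeFactors_dvd m)).coprime_dvd_right
      (Nat.prod_primeFactors_dvd n)
  rw [bcoef, h.rad_mul, ArithmeticFunction.isMultiplicative_moebius.map_mul_of_coprime hrad,
    Nat.totient_mul hrad, bcoef, bcoef]
  push_cast
  ring

lemma abs_bcoef_le {m : ℕ} (hm : m ≠ 0) : |bcoef m| ≤ m := by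
  rw [bcoef, abs_mul, Nat.abs_cast]
  calc _ ≤ 1 * (m : ℤ) := by
        gcongr
        · exact ArithmeticFunction.abs_moebius_le_one
        · exact (Nat.totient_le _).trans (Nat.rad_le hm)
    _ = m := one_mul _

lemma norm_bcoef_le {m : ℕ} (hm : m ≠ 0) : ‖(bcoef m : ℂ)‖ ≤ m := by
  rw [Complex.norm_intCast]
  exact_mod_cast abs_bcoef_le hm

/-- The Dirichlet convolution of `bcoef` with the identity is the constant function `1`. -/
lemma sum_divisorsAntidiagonal_bcoef {n : ℕ} (hn : n ≠ 0) :
    ∑ x ∈ n.divisorsAntidiagonal, bcoef x.1 * (x.2 : ℤ) = 1 := by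
  let b : ArithmeticFunction ℤ := ⟨fun n ↦ if n = 0 then 0 else bcoef n, if_pos rfl⟩
  have hb0 (n : ℕ) (hn : n ≠ 0) : b n = bcoef n := if_neg hn
  have hb : b.IsMultiplicative := by
    refine ArithmeticFunction.IsMultiplicative.iff_ne_zero.2
      ⟨(hb0 1 one_ne_zero).trans bcoef_one, fun {m n} hm hn hmn ↦ ?_⟩
    rw [hb0 _ (mul_ne_zero hm hn), hb0 m hm, hb0 n hn, bcoef_mul hmn]
  have hid : (ArithmeticFunction.id : ArithmeticFunction ℤ).IsMultiplicative :=
    ArithmeticFunction.isMultiplicative_id.natCast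
  have key : b * (ArithmeticFunction.id : ArithmeticFunction ℤ) = ArithmeticFunction.zeta := by
    rw [ArithmeticFunction.IsMultiplicative.eq_iff_eq_on_prime_powers _ (hb.mul hid) _
      ArithmeticFunction.isMultiplicative_zeta.natCast]
    intro p i hp
    rw [ArithmeticFunction.mul_apply,
      Nat.sum_divisorsAntidiagonal
        (fun a c ↦ b a * (ArithmeticFunction.id : ArithmeticFunction ℤ) c),
      Nat.sum_divisors_prime_pow hp]
    rw [ArithmeticFunction.natCoe_apply,
      ArithmeticFunction.zeta_apply_ne (pow_ne_zero i hp.ne_zero), Finset.sum_range_succ']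
    have hterm (j : ℕ) (hj : j ∈ Finset.range i) : b (p ^ (j + 1)) *
        (ArithmeticFunction.id : ArithmeticFunction ℤ) (p ^ i / p ^ (j + 1)) =
        (p : ℤ) ^ (i - 1 - j) * (1 - p) := by
      have hj : j < i := Finset.mem_range.1 hj
      rw [hb0 _ (pow_ne_zero _ hp.ne_zero), bcoef_prime_pow hp, Nat.pow_div hj hp.pos,
        show i - (j + 1) = i - 1 - j by omega]
      simp [mul_comm]
    rw [Finset.sum_congr rfl hterm, ← Finset.sum_mul,
      Finset.sum_range_reflect (fun j ↦ (p : ℤ) ^ j) i, pow_zero, hb0 1 one_ne_zero, bcoef_one]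
    have := geom_sum_mul (p : ℤ) i
    simp
    linear_combination -this
  have h := congrArg (fun f : ArithmeticFunction ℤ ↦ f n) key
  simp only [ArithmeticFunction.mul_apply] at h
  rw [ArithmeticFunction.natCoe_apply, ArithmeticFunction.zeta_apply_ne hn, Nat.cast_one] at h
  rw [← h]
  refine Finset.sum_congr rfl fun x hx ↦ ?_
  rw [hb0 _ (Nat.ne_zero_of_mem_divisorsAntidiagonal hx).1]
  simp

lemma pow_mul_le_two_mul_half_pow {m k : ℕ} (hm : 1 ≤ m) (hk : 1 ≤ k) {u : ℝ} (hu0 : 0 ≤ u) (hu : u ≤ 1 / 2) :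
    u ^ (m * k) ≤ 2 * ((1 / 2) ^ m * (1 / 2) ^ k) := by
  calc u ^ (m * k) ≤ (1 / 2) ^ (m * k) := by gcongr
    _ ≤ (1 / 2) ^ (m + k - 1) := by
      refine pow_le_pow_of_le_one (by norm_num) (by norm_num) ?_
      obtain ⟨m, rfl⟩ := Nat.exists_eq_add_of_le hm
      obtain ⟨k, rfl⟩ := Nat.exists_eq_add_of_le hk
      have : 0 ≤ m * k := Nat.zero_le _
      ring_nf; omega
    _ = _ := by
      rw [← pow_add]
      conv_rhs => rw [show m + k = (m + k - 1) + 1 by omega, pow_succ]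
      ring

lemma summable_bcoef_mul_pow {x : ℂ} (hx : ‖x‖ ≤ 1 / 2) :
    Summable fun c : ℕ+ × ℕ+ ↦ (bcoef c.1 : ℂ) * (c.2 * x ^ (c.1 * c.2 : ℕ)) := by
  have h1 : Summable fun n : ℕ+ ↦ (n : ℝ) * (1 / 2) ^ (n : ℕ) := by
    have := summable_pow_mul_geometric_of_norm_lt_one 1 (r := (1 / 2 : ℝ)) (by norm_num)
    simpa using! this.comp_injective PNat.coe_injective
  refine Summable.of_norm_bounded
    ((h1.mul_of_nonneg h1 (fun n ↦ by positivity) (fun n ↦ by positivity)).mul_left 2)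
    fun c ↦ ?_
  rw [norm_mul, norm_mul, norm_natCast, norm_pow]
  calc _ ≤ (c.1 : ℝ) * (c.2 * (2 * ((1 / 2) ^ (c.1 : ℕ) * (1 / 2) ^ (c.2 : ℕ)))) := by
        gcongr
        · exact norm_bcoef_le c.1.ne_zero
        · exact pow_mul_le_two_mul_half_pow c.1.pos c.2.pos (norm_nonneg x) hx
    _ = _ := by ring

lemma tsum_pnat_mul_pow {y : ℂ} (hy : ‖y‖ < 1) :
    ∑' k : ℕ+, (k : ℂ) * y ^ (k : ℕ) = y / (1 - y) ^ 2 := by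
  have h := hasSum_coe_mul_geometric_of_norm_lt_one hy
  rw [← h.tsum_eq, ← tsum_zero_pnat_eq_tsum_nat h.summable]
  simp

/-- A Lambert-type expansion of the geometric series. -/
lemma hasSum_lambert_bcoef {x : ℂ} (hx : ‖x‖ ≤ 1 / 2) :
    HasSum (fun m : ℕ+ ↦ (bcoef m : ℂ) * (x ^ (m : ℕ) / (1 - x ^ (m : ℕ)) ^ 2)) (x / (1 - x)) := by
  have hx1 : ‖x‖ < 1 := by linarith
  have hs := summable_bcoef_mul_pow hx
  have hinner (m : ℕ+) : ∑' k : ℕ+, (bcoef m : ℂ) * (k * x ^ (m * k : ℕ)) =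
      (bcoef m : ℂ) * (x ^ (m : ℕ) / (1 - x ^ (m : ℕ)) ^ 2) := by
    rw [tsum_mul_left, ← tsum_pnat_mul_pow (by
      rw [norm_pow]; exact pow_lt_one₀ (norm_nonneg x) hx1 m.ne_zero)]
    simp only [pow_mul]
  have hsum := hs.prod
  simp only [hinner] at hsum
  have hval : ∑' m : ℕ+, (bcoef m : ℂ) * (x ^ (m : ℕ) / (1 - x ^ (m : ℕ)) ^ 2) = x / (1 - x) := by
    simp only [← hinner]
    rw [← hs.tsum_prod, ← sigmaAntidiagonalEquivProd.tsum_eq]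
    have hs' := sigmaAntidiagonalEquivProd.summable_iff.2 hs
    refine (Summable.tsum_sigma hs').trans ?_
    have hn (n : ℕ+) : ∑' c : Nat.divisorsAntidiagonal n,
        (bcoef (sigmaAntidiagonalEquivProd ⟨n, c⟩).1 : ℂ) *
          ((sigmaAntidiagonalEquivProd ⟨n, c⟩).2 * x ^
            ((sigmaAntidiagonalEquivProd ⟨n, c⟩).1 * (sigmaAntidiagonalEquivProd ⟨n, c⟩).2 : ℕ)) =
        x ^ (n : ℕ) := by
      rw [tsum_fintype]
      simp only [sigmaAntidiagonalEquivProd, divisorsAntidiagonalFactors, PNat.mk_coe,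
        Equiv.coe_fn_mk, Finset.univ_eq_attach]
      rw [(n : ℕ).divisorsAntidiagonal.sum_attach
        (fun c : ℕ × ℕ ↦ (bcoef c.1 : ℂ) * (c.2 * x ^ (c.1 * c.2)))]
      calc _ = ∑ c ∈ (n : ℕ).divisorsAntidiagonal,
              ((bcoef c.1 * (c.2 : ℤ) : ℤ) : ℂ) * x ^ (n : ℕ) := by
            refine Finset.sum_congr rfl fun c hc ↦ ?_
            rw [(Nat.mem_divisorsAntidiagonal.1 hc).1]
            push_cast; ring
        _ = _ := by
            rw [← Finset.sum_mul, ← Int.cast_sum, sum_divisorsAntidiagonal_bcoef n.ne_zero]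
            simp
    simp only [Function.comp_def, hn]
    rw [tsum_pnat_eq_tsum_succ (f := fun n ↦ x ^ n)]
    simp only [pow_succ', tsum_mul_left, tsum_geometric_of_norm_lt_one hx1, div_eq_mul_inv]
  exact hval ▸ hsum.hasSum

/-- Truncation error in the Lambert-type expansion of the geometric series. -/
lemma norm_sub_sum_lambert_bcoef_le {x : ℂ} (hx : ‖x‖ ≤ 1 / 2) {M : ℕ} (hM : 1 ≤ M) :
    ‖x / (1 - x) - ∑ m ∈ Finset.Icc 1 M, (bcoef m : ℂ) * (x ^ m / (1 - x ^ m) ^ 2)‖ ≤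
      32 * M * ‖x‖ ^ (M + 1) := by
  set g : ℕ → ℂ := fun m ↦ (bcoef m : ℂ) * (x ^ m / (1 - x ^ m) ^ 2) with hg
  have h := hasSum_lambert_bcoef hx
  have hs : Summable fun n : ℕ ↦ g (n + 1) := by
    have := h.summable
    rwa [← Equiv.pnatEquivNat.symm.summable_iff] at this
  have hsplit : x / (1 - x) - ∑ m ∈ Finset.Icc 1 M, g m = ∑' k : ℕ, g (k + M + 1) := by
    rw [← h.tsum_eq, tsum_pnat_eq_tsum_succ (f := g), ← hs.sum_add_tsum_nat_add M,
      ← Finset.Ico_add_one_right_eq_Icc, Finset.sum_Ico_eq_sum_range]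
    simp [add_comm 1]
  have hterm (m : ℕ) (hm : 1 ≤ m) : ‖g m‖ ≤ 4 * m * ‖x‖ ^ m := by
    have h1 : ‖x‖ ^ m ≤ 1 / 2 :=
      (pow_le_of_le_one (norm_nonneg x) (by linarith) (by omega)).trans hx
    have h2 : 1 / 2 ≤ ‖1 - x ^ m‖ := by
      have := norm_sub_norm_le 1 (x ^ m)
      rw [norm_one, norm_pow] at this
      linarith
    rw [hg, norm_mul, norm_div, norm_pow, norm_pow]
    calc _ ≤ (m : ℝ) * (‖x‖ ^ m / (1 / 2) ^ 2) := by
          gcongr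
          exact norm_bcoef_le (by omega)
      _ = _ := by ring
  have hgeo : HasSum (fun k : ℕ ↦ ((k : ℝ) + 1) * (1 / 2) ^ k) 4 := by
    have h3 := hasSum_coe_mul_geometric_of_norm_lt_one (r := (1 / 2 : ℝ)) (by norm_num)
    have h4 := h3.add hasSum_geometric_two
    norm_num at h4
    convert! h4 using 2
    norm_num; ring
  rw [hsplit]
  refine (tsum_of_norm_bounded (hgeo.mul_left (8 * M * ‖x‖ ^ (M + 1))) fun k ↦ ?_).trans_eq
    (by ring)
  have hM' : (1 : ℝ) ≤ M := by exact_mod_cast hM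
  calc ‖g (k + M + 1)‖ ≤ 4 * (k + M + 1 : ℕ) * ‖x‖ ^ (k + M + 1) := hterm _ (by omega)
    _ = 4 * (k + M + 1) * (‖x‖ ^ (M + 1) * ‖x‖ ^ k) := by push_cast; ring
    _ ≤ 4 * (2 * M * (k + 1)) * (‖x‖ ^ (M + 1) * (1 / 2) ^ k) := by
        gcongr
        nlinarith [(Nat.cast_nonneg k : (0 : ℝ) ≤ k)]
    _ = _ := by ring

/-- Reindexing along prime powers. -/
lemma hasSum_primes_of_support_subset {f : ℕ → ℂ} (hf : Summable f)
    (hsupp : Function.support f ⊆ {n | IsPrimePow n}) :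
    HasSum (fun p : Nat.Primes ↦ ∑' k : ℕ, f (p ^ (k + 1))) (∑' n, f n) := by
  rw [tsum_eq_tsum_primes_of_support_subset_prime_powers hf hsupp]
  refine Summable.hasSum ?_
  have := (hf.comp_injective
    (Subtype.val_injective.comp Nat.Primes.prodNatEquiv.injective)).prod
  simpa using! this

lemma abscissaOfAbsConv_vonMangoldt_lt {s : ℂ} (hs : 1 < s.re) :
    LSeries.abscissaOfAbsConv (fun n ↦ (ArithmeticFunction.vonMangoldt n : ℂ)) < s.re := by
  obtain ⟨y, hy1, hy2⟩ := exists_between hs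
  refine lt_of_le_of_lt
    (LSeriesSummable.abscissaOfAbsConv_le
      (ArithmeticFunction.LSeriesSummable_vonMangoldt (s := y) (by simpa using hy1))) ?_
  simpa using hy2

lemma deriv_logDeriv_riemannZeta_eq_LSeries {s : ℂ} (hs : 1 < s.re) :
    deriv (logDeriv riemannZeta) s =
      LSeries (LSeries.logMul fun n ↦ (ArithmeticFunction.vonMangoldt n : ℂ)) s := by
  have hev : logDeriv riemannZeta =ᶠ[nhds s]
      fun z ↦ -LSeries (fun n ↦ (ArithmeticFunction.vonMangoldt n : ℂ)) z := by
    filter_upwards [(isOpen_lt continuous_const continuous_re).mem_nhds hs] with z hz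
    rw [ArithmeticFunction.LSeries_vonMangoldt_eq_deriv_riemannZeta_div hz, logDeriv_apply]
    ring
  rw [hev.deriv_eq, deriv.fun_neg, LSeries_deriv (abscissaOfAbsConv_vonMangoldt_lt hs), neg_neg]

lemma summable_logMul_vonMangoldt {s : ℂ} (hs : 1 < s.re) :
    LSeriesSummable (LSeries.logMul fun n ↦ (ArithmeticFunction.vonMangoldt n : ℂ)) s :=
  LSeriesSummable_logMul_of_lt_re (abscissaOfAbsConv_vonMangoldt_lt hs)

lemma Nat.Prime.norm_cpow_neg_le {p : ℕ} (hp : p.Prime) {s : ℂ} (hs : 1 < s.re) :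
    ‖(p : ℂ) ^ (-s)‖ ≤ 1 / 2 := by
  rw [norm_natCast_cpow_of_pos hp.pos, neg_re]
  have hp2 : (2 : ℝ) ≤ p := by exact_mod_cast hp.two_le
  calc (p : ℝ) ^ (-s.re) ≤ (p : ℝ) ^ (-1 : ℝ) :=
        Real.rpow_le_rpow_of_exponent_le (by linarith) (by linarith)
    _ = 1 / p := by rw [Real.rpow_neg_one, one_div]
    _ ≤ 1 / 2 := by gcongr

lemma natCast_pow_cpow_neg (p k : ℕ) (s : ℂ) : ((p ^ k : ℕ) : ℂ) ^ (-s) = ((p : ℂ) ^ (-s)) ^ k := by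
  rw [← cpow_nat_mul, Nat.cast_pow, ← natCast_cpow_natCast_mul, mul_comm]

/-- The derivative of the logarithmic derivative of `ζ` as a sum over primes. -/
lemma hasSum_primes_deriv_logDeriv_riemannZeta {s : ℂ} (hs : 1 < s.re) :
    HasSum (fun p : Nat.Primes ↦ (Real.log p : ℂ) ^ 2 *
      ((p : ℂ) ^ (-s) / (1 - (p : ℂ) ^ (-s)) ^ 2)) (deriv (logDeriv riemannZeta) s) := by
  rw [deriv_logDeriv_riemannZeta_eq_LSeries hs]
  have h := hasSum_primes_of_support_subset (summable_logMul_vonMangoldt hs) (fun n hn ↦ ?_)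
  · convert! h using 2 with p
    have hx : ‖(p : ℂ) ^ (-s)‖ < 1 := (p.2.norm_cpow_neg_le hs).trans_lt (by norm_num)
    have hgeo := hasSum_coe_mul_geometric_of_norm_lt_one hx
    have hgeo' := hgeo.summable.tsum_eq_zero_add
    rw [hgeo.tsum_eq, Nat.cast_zero, zero_mul, zero_add] at hgeo'
    rw [hgeo', ← tsum_mul_left]
    refine tsum_congr fun k ↦ ?_
    rw [LSeries.term_of_ne_zero (pow_ne_zero _ p.2.ne_zero), LSeries.logMul, div_eq_mul_inv,
      ← cpow_neg, natCast_pow_cpow_neg, ArithmeticFunction.vonMangoldt_apply_pow k.succ_ne_zero,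
      ArithmeticFunction.vonMangoldt_apply_prime p.2, ← natCast_log, Nat.cast_pow, Real.log_pow]
    push_cast
    ring
  · by_contra hn'
    rw [Set.mem_ofPred_eq, ← ArithmeticFunction.vonMangoldt_ne_zero_iff, not_not] at hn'
    exact hn (by simp [LSeries.term_def, LSeries.logMul, hn'])

lemma hasSum_primes_vonMangoldt_sq {s : ℂ} (hs : 1 < s.re) :
    HasSum (fun p : Nat.Primes ↦ (Real.log p : ℂ) ^ 2 *
      ((p : ℂ) ^ (-s) / (1 - (p : ℂ) ^ (-s))))
      (∑' n : ℕ, (ArithmeticFunction.vonMangoldt n : ℂ) ^ 2 / (n : ℂ) ^ s) := by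
  have hsum : Summable fun n : ℕ ↦ (ArithmeticFunction.vonMangoldt n : ℂ) ^ 2 / (n : ℂ) ^ s := by
    refine Summable.of_norm_bounded (summable_logMul_vonMangoldt hs).norm fun n ↦ ?_
    rcases eq_or_ne n 0 with rfl | hn
    · simp
    rw [LSeries.term_of_ne_zero hn, LSeries.logMul, norm_div, norm_div, sq, norm_mul, norm_mul,
      ← natCast_log, norm_real, norm_real, Real.norm_of_nonneg ArithmeticFunction.vonMangoldt_nonneg,
      Real.norm_of_nonneg (Real.log_natCast_nonneg n)]
    gcongr
    exact ArithmeticFunction.vonMangoldt_le_log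
  have h := hasSum_primes_of_support_subset hsum (fun n hn ↦ ?_)
  · convert! h using 2 with p
    have hx : ‖(p : ℂ) ^ (-s)‖ < 1 := (p.2.norm_cpow_neg_le hs).trans_lt (by norm_num)
    rw [div_eq_mul_inv, ← tsum_geometric_of_norm_lt_one hx, ← tsum_mul_left, ← tsum_mul_left]
    refine tsum_congr fun k ↦ ?_
    rw [div_eq_mul_inv, ← cpow_neg, natCast_pow_cpow_neg,
      ArithmeticFunction.vonMangoldt_apply_pow k.succ_ne_zero,
      ArithmeticFunction.vonMangoldt_apply_prime p.2]
    ring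
  · by_contra hn'
    rw [Set.mem_ofPred_eq, ← ArithmeticFunction.vonMangoldt_ne_zero_iff, not_not] at hn'
    exact hn (by simp [hn'])

lemma natCast_rpow_neg_pow_succ_le {p : ℕ} (hp : 2 ≤ p) {σ : ℝ} (hσ : 1 ≤ σ) {M : ℕ} (hM : 4 ≤ M) :
    ((p : ℝ) ^ (-σ)) ^ (M + 1) ≤ 16 / (p : ℝ) ^ 4 * 2 ^ (-σ * M) := by
  have hp' : (2 : ℝ) ≤ p := by exact_mod_cast hp
  have hp0 : (0 : ℝ) < p := by linarith
  set r : ℝ := (2 / p) ^ σ with hr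
  have hq1 : 2 / (p : ℝ) ≤ 1 := (div_le_one hp0).2 hp'
  have hr0 : 0 ≤ r := by positivity
  have hr1 : r ≤ 2 / p := by
    simpa using Real.rpow_le_rpow_of_exponent_ge (by positivity) hq1 hσ
  have heq : (p : ℝ) ^ (-σ) = r * 2 ^ (-σ) := by
    rw [hr, Real.div_rpow (by norm_num) hp0.le, Real.rpow_neg hp0.le, Real.rpow_neg (by norm_num)]
    have : (2 : ℝ) ^ σ ≠ 0 := by positivity
    field_simp
  have h2 : ((2 : ℝ) ^ (-σ)) ^ (M + 1) ≤ 2 ^ (-σ * M) := by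
    rw [← Real.rpow_natCast, ← Real.rpow_mul (by norm_num)]
    refine Real.rpow_le_rpow_of_exponent_le (by norm_num) ?_
    push_cast
    nlinarith
  have h3 : r ^ (M + 1) ≤ 16 / (p : ℝ) ^ 4 := by
    calc r ^ (M + 1) ≤ r ^ 4 := pow_le_pow_of_le_one hr0 (hr1.trans hq1) (by omega)
      _ ≤ (2 / p) ^ 4 := by gcongr
      _ = _ := by rw [div_pow]; norm_num
  rw [heq, mul_pow]
  gcongr

/-- The explicit formula `K(s) = ∑_{m=1}^M (b_m/m²)(1/(s-1/m)² - ∑*_ρ 1/(s-ρ/m)²) + O(M·2^{-σM})`,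
where `∑*_ρ` runs over all zeros of `ζ` (trivial and nontrivial) with multiplicity, with an
absolute implied constant. -/
theorem vonMangoldt_sq_explicit_formula :
    ∃ C : ℝ, ∀ M : ℕ, 4 ≤ M → ∀ s : ℂ, 1 < s.re →
      ‖(∑' n : ℕ, (ArithmeticFunction.vonMangoldt n : ℂ) ^ 2 / (n : ℂ) ^ s) -
          ∑ m ∈ Finset.Icc 1 M, ((bcoef m : ℂ) / (m : ℂ) ^ 2) *
            (1 / (s - 1 / (m : ℂ)) ^ 2 -
              ∑' ρ : ℂ, (zeroMult riemannZeta ρ : ℂ) / (s - ρ / (m : ℂ)) ^ 2)‖ ≤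
        C * M * (2 : ℝ) ^ (-(s.re) * M) := by
  have hsq : Summable fun p : Nat.Primes ↦ 1 / ((p : ℕ) : ℝ) ^ 2 :=
    (Real.summable_one_div_nat_pow.2 one_lt_two).comp_injective Nat.Primes.coe_nat_injective
  refine ⟨512 * ∑' p : Nat.Primes, 1 / ((p : ℕ) : ℝ) ^ 2, fun M hM s hs ↦ ?_⟩
  have hms (m : ℕ) (hm : m ∈ Finset.Icc 1 M) : 1 < ((m : ℂ) * s).re := by
    have : (1 : ℝ) ≤ m := by exact_mod_cast (Finset.mem_Icc.1 hm).1
    rw [← ofReal_natCast, re_ofReal_mul]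
    nlinarith
  have hterm (m : ℕ) (hm : m ∈ Finset.Icc 1 M) : ((bcoef m : ℂ) / (m : ℂ) ^ 2) *
      (1 / (s - 1 / (m : ℂ)) ^ 2 -
        ∑' ρ : ℂ, (zeroMult riemannZeta ρ : ℂ) / (s - ρ / (m : ℂ)) ^ 2) =
      (bcoef m : ℂ) * deriv (logDeriv riemannZeta) (m * s) := by
    have hm0 : (m : ℂ) ≠ 0 := by
      have := (Finset.mem_Icc.1 hm).1
      exact_mod_cast (by omega : m ≠ 0)
    have hscale (c ρ : ℂ) : c / (s - ρ / m) ^ 2 = (m : ℂ) ^ 2 * (c / (m * s - ρ) ^ 2) := by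
      rw [show s - ρ / m = (m * s - ρ) / m by field_simp, div_pow, div_div_eq_mul_div]
      ring
    simp only [hscale]
    rw [tsum_mul_left, ← mul_sub, ← deriv_logDeriv_riemannZeta (hms m hm)]
    field_simp
  rw [Finset.sum_congr rfl hterm]
  have hsum := (hasSum_primes_vonMangoldt_sq hs).sub (hasSum_sum fun m hm ↦
    (hasSum_primes_deriv_logDeriv_riemannZeta (hms m hm)).mul_left (bcoef m : ℂ))
  rw [← hsum.tsum_eq]
  refine (tsum_of_norm_bounded (hsq.hasSum.mul_left (512 * M * (2 : ℝ) ^ (-(s.re) * M)))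
    fun p ↦ ?_).trans_eq (by ring)
  have hp0 : (0 : ℝ) < (p : ℕ) := by exact_mod_cast p.2.pos
  have hx := p.2.norm_cpow_neg_le hs
  have hpow (m : ℕ) : ((p : ℕ) : ℂ) ^ (-(m * s)) = (((p : ℕ) : ℂ) ^ (-s)) ^ m := by
    rw [← cpow_nat_mul, mul_neg]
  have hfactor : (Real.log p : ℂ) ^ 2 * (((p : ℕ) : ℂ) ^ (-s) / (1 - ((p : ℕ) : ℂ) ^ (-s))) -
      ∑ m ∈ Finset.Icc 1 M, (bcoef m : ℂ) * ((Real.log p : ℂ) ^ 2 *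
        (((p : ℕ) : ℂ) ^ (-(m * s)) / (1 - ((p : ℕ) : ℂ) ^ (-(m * s))) ^ 2)) =
      (Real.log p : ℂ) ^ 2 * (((p : ℕ) : ℂ) ^ (-s) / (1 - ((p : ℕ) : ℂ) ^ (-s)) -
        ∑ m ∈ Finset.Icc 1 M, (bcoef m : ℂ) * ((((p : ℕ) : ℂ) ^ (-s)) ^ m /
          (1 - (((p : ℕ) : ℂ) ^ (-s)) ^ m) ^ 2)) := by
    rw [mul_sub, Finset.mul_sum]
    congr 1
    refine Finset.sum_congr rfl fun m _ ↦ ?_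
    rw [hpow]
    ring
  have hlog : ‖(Real.log p : ℂ) ^ 2‖ ≤ ((p : ℕ) : ℝ) ^ 2 := by
    rw [norm_pow, norm_real, Real.norm_of_nonneg (Real.log_natCast_nonneg _)]
    gcongr
    exact Real.log_le_self hp0.le
  rw [hfactor, norm_mul]
  calc _ ≤ ((p : ℕ) : ℝ) ^ 2 * (32 * M * ‖((p : ℕ) : ℂ) ^ (-s)‖ ^ (M + 1)) := by
        gcongr
        exact norm_sub_sum_lambert_bcoef_le hx (by omega)
    _ ≤ ((p : ℕ) : ℝ) ^ 2 * (32 * M * (16 / ((p : ℕ) : ℝ) ^ 4 * 2 ^ (-(s.re) * M))) := by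
        gcongr
        rw [norm_natCast_cpow_of_pos p.2.pos, neg_re]
        exact natCast_rpow_neg_pow_succ_le p.2.two_le hs.le hM
    _ = 512 * M * (2 : ℝ) ^ (-(s.re) * M) * (1 / ((p : ℕ) : ℝ) ^ 2) := by
        field_simp
        norm_num
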